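/- arXiv:2001.09962 — 3 statements merged into one kernel-verified Lean document; each statement's English description precedes it below -/
import Mathlib

section
/- Let Φ be a unital positive linear map on B(H), let f : (0,∞) → (0,∞) be a continuous function such that f² is operator concave, and let 0 ≤ r ≤ 1/2. Then for every positive invertible operator A ∈ B(H), |Φ(f(A)^{-1})^{-r} Φ(A)^r| ≤ Φ(A f(A))^r. -/
open scoped NNReal

variable {H : Type*} [NormedAddCommGroup H] [InnerProductSpace ℂ H] [CompleteSpace H]

/-- The absolute value `|X| = (X*X)^(1/2)` of a bounded operator `X` on a Hilbert space. -/
noncomputable def opAbs (X : H →L[ℂ] H) : H →L[ℂ] H := CFC.sqrt (star X * X)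

/-- `Φ` is a unital positive linear map on `B(H)`: `Φ(I) = I` and `Φ(X) ≥ 0` whenever `X ≥ 0`
(with respect to the Löwner order). -/
def IsUnitalPositiveMap (Φ : (H →L[ℂ] H) →ₗ[ℂ] (H →L[ℂ] H)) : Prop :=
  Φ 1 = 1 ∧ ∀ X : H →L[ℂ] H, 0 ≤ X → 0 ≤ Φ X

/-- `f : (0,∞) → (0,∞)` is operator convex: for all positive invertible operators `A, B` on `H`
and all `c ∈ [0,1]`, `f(cA + (1-c)B) ≤ c f(A) + (1-c) f(B)` in the Löwner order, where `f(A)` is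
given by the continuous functional calculus. -/
def IsOperatorConvexOn (H : Type*) [NormedAddCommGroup H] [InnerProductSpace ℂ H]
    [CompleteSpace H] (f : ℝ → ℝ) : Prop :=
  ∀ (A B : H →L[ℂ] H), 0 ≤ A → IsUnit A → 0 ≤ B → IsUnit B →
    ∀ c : ℝ, c ∈ Set.Icc (0 : ℝ) 1 →
      cfc f (c • A + (1 - c) • B) ≤ c • cfc f A + (1 - c) • cfc f B

/-- `f : (0,∞) → (0,∞)` is operator concave if `-f` is operator convex. -/
def IsOperatorConcaveOn (H : Type*) [NormedAddCommGroup H] [InnerProductSpace ℂ H]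
    [CompleteSpace H] (f : ℝ → ℝ) : Prop :=
  IsOperatorConvexOn H (fun t => -(f t))


open Polynomial in
/-- A real polynomial that is positive on `[0, ∞)` is a sum of polynomials `q²` and `X q²` of no
larger degree. -/
theorem positive_halfLine_induction {P : ℝ[X] → Prop} {n : ℕ}
    (hadd : ∀ p q, P p → P q → P (p + q))
    (hsq : ∀ q : ℝ[X], 2 * q.natDegree ≤ n → P (q ^ 2))
    (hXsq : ∀ q : ℝ[X], 2 * q.natDegree + 1 ≤ n → P (X * q ^ 2))
    {p : ℝ[X]} (hn : p.natDegree ≤ n) (hp : ∀ s : ℝ, 0 ≤ s → 0 < p.eval s) : P p := by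
  -- Generalize to `p * w` with `w` one of the two elementary types.
  suffices key : ∀ d : ℕ, ∀ p : ℝ[X], p.natDegree = d → (∀ s : ℝ, 0 ≤ s → 0 < p.eval s) →
      ∀ q : ℝ[X], (d + 2 * q.natDegree ≤ n → P (p * q ^ 2)) ∧
        (d + 2 * q.natDegree + 1 ≤ n → P (p * (X * q ^ 2))) by
    simpa using (key _ p rfl hp 1).1 (by simpa using hn)
  intro d
  induction d using Nat.strong_induction_on with
  | _ d ih =>
  intro p hd hp q
  rcases Nat.eq_zero_or_pos d with rfl | hdpos
  · obtain ⟨c, rfl⟩ := natDegree_eq_zero.mp hd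
    have hc : 0 < c := by simpa using hp 0 le_rfl
    have e : (C c : ℝ[X]) = C (√c) ^ 2 := by
      rw [← C_pow, Real.sq_sqrt hc.le]
    have hdeg : (C (√c) * q).natDegree ≤ q.natDegree := natDegree_C_mul_le _ _
    constructor
    · intro h
      rw [e, ← mul_pow]
      exact hsq _ (by omega)
    · intro h
      have : C c * (X * q ^ 2) = X * (C (√c) * q) ^ 2 := by rw [e]; ring
      rw [this]
      exact hXsq _ (by omega)
  · obtain ⟨g, hgm, hgi, p₁, rfl⟩ := exists_monic_irreducible_factor p
      (not_isUnit_of_natDegree_pos p (by omega))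
    have hp₁0 : p₁ ≠ 0 := by
      rintro rfl
      simpa using hp 0 le_rfl
    have hdeg : g.natDegree + p₁.natDegree = d := by
      rw [← hd, natDegree_mul hgm.ne_zero hp₁0]
    have hgne : ∀ s : ℝ, 0 ≤ s → g.eval s ≠ 0 := by
      intro s hs h0
      have := hp s hs
      simp [h0] at this
    have hgpos : ∀ s : ℝ, 0 ≤ s → 0 < g.eval s := by
      have htop : Filter.Tendsto (fun x => g.eval x) Filter.atTop Filter.atTop :=
        g.tendsto_atTop_of_leadingCoeff_nonneg (natDegree_pos_iff_degree_pos.mp hgi.natDegree_pos)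
          (by simp [hgm.leadingCoeff])
      obtain ⟨b, hb0, hb⟩ := ((Filter.eventually_ge_atTop (0 : ℝ)).and
        (htop.eventually_gt_atTop 0)).exists
      intro s hs
      by_contra hcon
      push Not at hcon
      obtain ⟨z, hz, hz0⟩ := isPreconnected_Ici.intermediate_value (s := Set.Ici (0 : ℝ))
        (Set.mem_Ici.mpr hs) (Set.mem_Ici.mpr hb0) g.continuous.continuousOn ⟨hcon, hb.le⟩
      exact hgne z hz hz0
    have hp₁pos : ∀ s : ℝ, 0 ≤ s → 0 < p₁.eval s := by
      intro s hs
      have h := hp s hs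
      rw [eval_mul] at h
      exact (pos_iff_pos_of_mul_pos h).mp (hgpos s hs)
    have hg2 := hgi.natDegree_le_two
    have hg1 := hgi.natDegree_pos
    have IH := ih p₁.natDegree (by omega) p₁ rfl hp₁pos
    have hX1 : ∀ q : ℝ[X], (X * q).natDegree ≤ q.natDegree + 1 := fun q =>
      natDegree_mul_le.trans (by rw [natDegree_X]; omega)
    have hC1 : ∀ (c : ℝ) (q : ℝ[X]), (C c * q).natDegree ≤ q.natDegree := fun c q =>
      natDegree_C_mul_le _ _
    interval_cases hgd : g.natDegree
    · have hg : g = X + C (g.coeff 0) := by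
        have := g.as_sum_range_C_mul_X_pow
        rw [hgd] at this
        simp [Finset.sum_range_succ] at this
        have h1 : g.coeff 1 = 1 := by rw [← hgd]; exact hgm
        rw [h1] at this
        rw [this]; simp [add_comm]
      set a := g.coeff 0
      have ha : 0 < a := by have := hgpos 0 le_rfl; rw [hg] at this; simpa using this
      have e : (C a : ℝ[X]) = C (√a) ^ 2 := by rw [← C_pow, Real.sq_sqrt ha.le]
      have hq1 := hC1 (√a) q
      have hq2 := hX1 q
      constructor
      · intro h
        have : g * p₁ * q ^ 2 = p₁ * (X * q ^ 2) + p₁ * (C (√a) * q) ^ 2 := by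
          rw [hg, e]; ring
        rw [this]
        exact hadd _ _ ((IH q).2 (by omega)) ((IH _).1 (by omega))
      · intro h
        have : g * p₁ * (X * q ^ 2) = p₁ * (X * q) ^ 2 + p₁ * (X * (C (√a) * q) ^ 2) := by
          rw [hg, e]; ring
        rw [this]
        exact hadd _ _ ((IH _).1 (by omega)) ((IH _).2 (by omega))
    · have hg : g = X ^ 2 + C (g.coeff 1) * X + C (g.coeff 0) := by
        have := g.as_sum_range_C_mul_X_pow
        rw [hgd] at this
        simp [Finset.sum_range_succ] at this
        have h1 : g.coeff 2 = 1 := by rw [← hgd]; exact hgm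
        rw [h1] at this
        rw [this]; simp [add_comm, add_left_comm]
      set a := g.coeff 0
      set b := g.coeff 1
      have ha : 0 < a := by have := hgpos 0 le_rfl; rw [hg] at this; simpa using this
      have hb : 0 ≤ b + 2 * √a := by
        have := hgpos (√a) (Real.sqrt_nonneg a)
        rw [hg] at this
        simp only [eval_add, eval_mul, eval_pow, eval_X, eval_C, Real.sq_sqrt ha.le] at this
        have hs := Real.sqrt_pos.mpr ha
        have h2 := Real.sq_sqrt ha.le
        by_contra hneg
        push Not at hneg
        nlinarith
      set c := √a with hc
      set e := √(b + 2 * c) with he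
      have hgd' : g = (X - C c) ^ 2 + C e ^ 2 * X := by
        have h1 : a = c ^ 2 := (Real.sq_sqrt ha.le).symm
        have h2 : b = e ^ 2 - 2 * c := by rw [he, Real.sq_sqrt hb]; ring
        rw [hg, h1, h2]
        simp only [C_sub, C_mul, C_pow, C_ofNat]
        ring
      have hq1 := hC1 e q
      have hq2 := hX1 q
      have hq3 := hX1 (C e * q)
      have hq4 : ((X - C c) * q).natDegree ≤ q.natDegree + 1 :=
        natDegree_mul_le.trans (by rw [natDegree_X_sub_C]; omega)
      constructor
      · intro h
        have : g * p₁ * q ^ 2 = p₁ * ((X - C c) * q) ^ 2 + p₁ * (X * (C e * q) ^ 2) := by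
          rw [hgd']; ring
        rw [this]
        exact hadd _ _ ((IH _).1 (by omega)) ((IH _).2 (by omega))
      · intro h
        have : g * p₁ * (X * q ^ 2)
            = p₁ * (X * ((X - C c) * q) ^ 2) + p₁ * (X * (C e * q)) ^ 2 := by
          rw [hgd']; ring
        rw [this]
        exact hadd _ _ ((IH _).2 (by omega)) ((IH _).1 (by omega))

/-- The convex hull of a compact set in a finite-dimensional space is compact. -/
theorem IsCompact.convexHull_of_finiteDimensional {E : Type*} [NormedAddCommGroup E]
    [NormedSpace ℝ E] [FiniteDimensional ℝ E] {s : Set E} (hs : IsCompact s) :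
    IsCompact (convexHull ℝ s) := by
  let F (n : ℕ) : Set E := (fun p : (Fin n → ℝ) × (Fin n → E) => ∑ i, p.1 i • p.2 i) ''
    (stdSimplex ℝ (Fin n) ×ˢ Set.univ.pi fun _ => s)
  have hF : ∀ n, IsCompact (F n) := fun n =>
    ((isCompact_stdSimplex ℝ (Fin n)).prod (isCompact_univ_pi fun _ => hs)).image (by fun_prop)
  have : convexHull ℝ s = ⋃ n ∈ Finset.range (Module.finrank ℝ E + 2), F n := by
    apply Set.Subset.antisymm
    · intro x hx
      rw [convexHull_eq_union] at hx
      simp only [Set.mem_iUnion] at hx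
      obtain ⟨t, hts, hai, hx⟩ := hx
      rw [Finset.convexHull_eq] at hx
      obtain ⟨w, hw0, hw1, rfl⟩ := hx
      have hcard : t.card ≤ Module.finrank ℝ E + 1 := by
        have := hai.card_le_finrank_succ
        simp only [Fintype.card_coe] at this
        exact this.trans (by gcongr; exact Submodule.finrank_le _)
      simp only [Set.mem_iUnion, Finset.mem_range]
      refine ⟨t.card, by omega, ⟨fun i => w (t.equivFin.symm i), fun i => t.equivFin.symm i⟩,
        ⟨⟨fun i => hw0 _ (t.equivFin.symm i).2, ?_⟩, fun i _ => hts (t.equivFin.symm i).2⟩, ?_⟩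
      · rw [← hw1, ← Finset.sum_coe_sort t]
        exact t.equivFin.symm.sum_comp fun i : t => w i
      · rw [Finset.centerMass_eq_of_sum_1 _ _ hw1, ← Finset.sum_coe_sort t]
        exact t.equivFin.symm.sum_comp fun i : t => w i • (i : E)
    · intro x hx
      simp only [Set.mem_iUnion] at hx
      obtain ⟨n, -, ⟨w, z⟩, ⟨hw, hz⟩, rfl⟩ := hx
      exact mem_convexHull_of_exists_fintype w z hw.1 hw.2 (fun i => hz i trivial) rfl
  rw [this]
  exact Finset.isCompact_biUnion _ fun n _ => hF n

/-- A positive invertible operator has its spectrum in a compact subinterval of `(0, ∞)`. -/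
theorem exists_spectrum_subset_Icc {A : H →L[ℂ] H} (hA : 0 ≤ A) (hAu : IsUnit A) :
    ∃ a b : ℝ, 0 < a ∧ a ≤ b ∧ spectrum ℝ A ⊆ Set.Icc a b := by
  have hpos : ∀ t ∈ spectrum ℝ A, 0 < t := fun t ht =>
    lt_of_le_of_ne (spectrum_nonneg_of_nonneg hA ht)
      fun h => spectrum.zero_notMem ℝ hAu (h ▸ ht)
  rcases (spectrum ℝ A).eq_empty_or_nonempty with h | h
  · exact ⟨1, 1, one_pos, le_rfl, by simp [h]⟩
  · have hc : IsCompact (spectrum ℝ A) := spectrum.isCompact A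
    obtain ⟨a, ha, ha'⟩ := hc.exists_isLeast h
    obtain ⟨b, hb, hb'⟩ := hc.exists_isGreatest h
    exact ⟨a, b, hpos a ha, ha' hb, fun t ht => ⟨ha' ht, hb' ht⟩⟩

theorem spectrum_subset_Ioi {A : H →L[ℂ] H} (hA : 0 ≤ A) (hAu : IsUnit A) :
    spectrum ℝ A ⊆ Set.Ioi 0 := by
  obtain ⟨a, b, ha, -, h⟩ := exists_spectrum_subset_Icc hA hAu
  exact fun t ht => ha.trans_le (h ht).1

/-- The continuous functional calculus acts on eigenvectors through the eigenvalue. -/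
theorem cfc_apply_of_eigenvector {f : ℝ → ℝ} (hf : ContinuousOn f (Set.Ioi 0)) {A : H →L[ℂ] H}
    (hA : 0 ≤ A) (hAu : IsUnit A) {v : H} {x : ℝ} (hv : A v = (x : ℂ) • v) :
    cfc f A v = (f x : ℂ) • v := by
  rcases eq_or_ne v 0 with rfl | hv0
  · simp
  obtain ⟨a, b, ha, -, hab⟩ := exists_spectrum_subset_Icc hA hAu
  have hsa : IsSelfAdjoint A := hA.isSelfAdjoint
  have hx : x ∈ spectrum ℝ A := by
    rw [spectrum.mem_iff]
    intro hu
    obtain ⟨B, hB⟩ := hu.exists_left_inv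
    apply hv0
    have : (algebraMap ℝ (H →L[ℂ] H) x - A) v = 0 := by
      rw [sub_apply, hv, Algebra.algebraMap_eq_smul_one]
      simp
    have h2 := congrArg (fun T : H →L[ℂ] H => T v) hB
    simpa [this] using h2.symm
  have hpoly : ∀ p : Polynomial ℝ, Polynomial.aeval A p v = ((p.eval x : ℝ) : ℂ) • v := by
    intro p
    induction p using Polynomial.induction_on' with
    | add p q hp hq => simp [hp, hq, add_smul]
    | monomial n c =>
      have hpow : (A ^ n) v = ((x : ℂ) ^ n) • v := by
        induction n with
        | zero => simp
        | succ n ih =>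
          rw [pow_succ, mul_apply_eq_comp, hv, map_smul, ih, smul_smul]
          ring_nf
      rw [Polynomial.aeval_monomial, Algebra.algebraMap_eq_smul_one]
      simp [hpow, mul_smul, Complex.coe_smul]
  rw [← sub_eq_zero, ← norm_le_zero_iff]
  refine le_of_forall_pos_le_add fun ε hε => ?_
  have hvn : 0 < ‖v‖ := norm_pos_iff.mpr hv0
  obtain ⟨p, hp⟩ := exists_polynomial_near_of_continuousOn a b f
    (hf.mono fun t ht => ha.trans_le ht.1) (ε / (2 * ‖v‖)) (by positivity)
  have hfc : ContinuousOn f (spectrum ℝ A) := hf.mono (spectrum_subset_Ioi hA hAu)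
  have h1 : ‖cfc f A - Polynomial.aeval A p‖ ≤ ε / (2 * ‖v‖) := by
    rw [← cfc_polynomial p A hsa, ← cfc_sub f (fun t => p.eval t) A hfc]
    refine norm_cfc_le (by positivity) fun t ht => ?_
    rw [norm_sub_rev]
    exact (hp t (hab ht)).le
  have h2 : cfc f A v - (f x : ℂ) • v
      = (cfc f A - Polynomial.aeval A p) v + ((p.eval x - f x : ℝ) : ℂ) • v := by
    rw [sub_apply, hpoly]
    push_cast
    rw [sub_smul]
    abel
  rw [h2]
  refine (norm_add_le _ _).trans ?_
  have h3 := (cfc f A - Polynomial.aeval A p).le_of_opNorm_le h1 v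
  have h4 : ‖((p.eval x - f x : ℝ) : ℂ) • v‖ ≤ ε / (2 * ‖v‖) * ‖v‖ := by
    rw [norm_smul, Complex.norm_real]
    gcongr
    exact (hp x (hab hx)).le
  have h5 : ε / (2 * ‖v‖) * ‖v‖ = ε / 2 := by field_simp
  linarith

theorem IsOperatorConcaveOn.smul_cfc_add_le {f : ℝ → ℝ} (hf : IsOperatorConcaveOn H f)
    {A B : H →L[ℂ] H} (hA : 0 ≤ A) (hAu : IsUnit A) (hB : 0 ≤ B) (hBu : IsUnit B)
    {c : ℝ} (hc : c ∈ Set.Icc (0 : ℝ) 1) :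
    c • cfc f A + (1 - c) • cfc f B ≤ cfc f (c • A + (1 - c) • B) := by
  have h := hf A B hA hAu hB hBu c hc
  simp only [cfc_neg] at h
  rw [← neg_le_neg_iff]
  simpa [add_comm] using h

/-- The operator acting as multiplication by `c i` on `e i` and as the identity on the orthogonal
complement of all the `e i`. -/
noncomputable def diagOperator {ι : Type*} [Fintype ι] (e : ι → H) (c : ι → ℝ) : H →L[ℂ] H :=
  1 + ∑ i, ((c i - 1 : ℝ) : ℂ) • InnerProductSpace.rankOne ℂ (e i) (e i)

section diagOperator

variable {ι : Type*} [Fintype ι] {e : ι → H}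

theorem diagOperator_apply_self (he : Orthonormal ℂ e) (c : ι → ℝ) (i : ι) :
    diagOperator e c (e i) = (c i : ℂ) • e i := by
  classical
  simp [diagOperator, orthonormal_iff_ite.mp he, sub_smul, sum_apply]

theorem diagOperator_mul (he : Orthonormal ℂ e) (c d : ι → ℝ) :
    diagOperator e c * diagOperator e d = diagOperator e (c * d) := by
  ext v
  have h : ∀ c : ι → ℝ, ∀ v, diagOperator e c v
      = v + ∑ i, ((c i - 1 : ℝ) : ℂ) • inner ℂ (e i) v • e i := by
    intro c v
    simp [diagOperator, sum_apply]
  rw [mul_apply_eq_comp, h d v, map_add, map_sum, h c v, h (c * d) v, add_assoc,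
    ← Finset.sum_add_distrib]
  congr 1
  refine Finset.sum_congr rfl fun i _ => ?_
  rw [map_smul, map_smul, diagOperator_apply_self he]
  simp only [smul_smul, ← add_smul, Pi.mul_apply]
  congr 1
  push_cast
  ring

theorem diagOperator_one : diagOperator e 1 = 1 := by
  simp [diagOperator]

theorem isSelfAdjoint_diagOperator (c : ι → ℝ) : IsSelfAdjoint (diagOperator e c) := by
  refine (IsSelfAdjoint.one _).add ?_
  refine isSelfAdjoint_sum _ fun i _ => ?_
  exact IsSelfAdjoint.smul (by simp [isSelfAdjoint_iff])
    (InnerProductSpace.isPositive_rankOne_self (e i)).isSelfAdjoint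

theorem diagOperator_nonneg (he : Orthonormal ℂ e) {c : ι → ℝ} (hc : ∀ i, 0 < c i) :
    0 ≤ diagOperator e c := by
  have h : diagOperator e c = star (diagOperator e fun i => √(c i))
      * diagOperator e fun i => √(c i) := by
    rw [(isSelfAdjoint_diagOperator _).star_eq, diagOperator_mul he]
    congr 1
    ext i
    simp [Real.mul_self_sqrt (hc i).le]
  rw [h]
  exact star_mul_self_nonneg _

theorem isUnit_diagOperator (he : Orthonormal ℂ e) {c : ι → ℝ} (hc : ∀ i, 0 < c i) :
    IsUnit (diagOperator e c) := by
  have h : c * c⁻¹ = 1 := by ext i; simp [(hc i).ne']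
  exact ⟨⟨diagOperator e c, diagOperator e c⁻¹, by rw [diagOperator_mul he, h, diagOperator_one],
    by rw [diagOperator_mul he, mul_comm, h, diagOperator_one]⟩, rfl⟩

end diagOperator

theorem re_inner_le_of_le {A B : H →L[ℂ] H} (h : A ≤ B) (v : H) :
    (inner ℂ v (A v)).re ≤ (inner ℂ v (B v)).re := by
  have := ((ContinuousLinearMap.le_def A B).mp h).re_inner_nonneg_right v
  rw [sub_apply, inner_sub_right, map_sub] at this
  exact sub_nonneg.mp this

/-- If `f` is positive and `f²` is operator concave, then so is `f`. -/
theorem IsOperatorConcaveOn.of_sq {f : ℝ → ℝ} (hfc : ContinuousOn f (Set.Ioi 0))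
    (hfpos : ∀ t ∈ Set.Ioi (0 : ℝ), 0 < f t) (hf2 : IsOperatorConcaveOn H (fun t => f t ^ 2)) :
    IsOperatorConcaveOn H f := by
  intro A B hA hAu hB hBu c hc
  have hsq : ∀ X : H →L[ℂ] H, 0 ≤ X → IsUnit X →
      0 ≤ cfc f X ∧ CFC.sqrt (cfc (fun t => f t ^ 2) X) = cfc f X := by
    intro X hX hXu
    have hs := spectrum_subset_Ioi hX hXu
    have h0 : 0 ≤ cfc f X := cfc_nonneg fun t ht => (hfpos t (hs ht)).le
    refine ⟨h0, ?_⟩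
    rw [cfc_pow f 2 X (hfc.mono hs) (ha := hX.isSelfAdjoint), CFC.sqrt_sq _ h0]
  have hCs : IsStrictlyPositive (c • A + (1 - c) • B) := by
    have hA' : IsStrictlyPositive A := hAu.isStrictlyPositive hA
    have hB' : IsStrictlyPositive B := hBu.isStrictlyPositive hB
    rcases hc.1.eq_or_lt with h | h
    · simpa [← h] using hB'
    · exact (hA'.smul h).add_nonneg (smul_nonneg (sub_nonneg.mpr hc.2) hB)
  obtain ⟨hA0, hA1⟩ := hsq A hA hAu
  obtain ⟨hB0, hB1⟩ := hsq B hB hBu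
  obtain ⟨hC0, hC1⟩ := hsq _ hCs.nonneg hCs.isUnit
  have h1 := CFC.monotone_sqrt (hf2.smul_cfc_add_le hA hAu hB hBu hc)
  have hsn : ∀ X : H →L[ℂ] H, 0 ≤ cfc (fun t => f t ^ 2) X :=
    fun X => cfc_nonneg fun t _ => sq_nonneg _
  have h2 := CFC.concaveOn_sqrt.2 (Set.mem_Ici.mpr (hsn A)) (Set.mem_Ici.mpr (hsn B)) hc.1
    (sub_nonneg.mpr hc.2) (by ring)
  rw [hA1, hB1] at h2
  rw [hC1] at h1
  simp only [cfc_neg]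
  rw [← neg_le_neg_iff]
  simpa [add_comm] using h2.trans h1

theorem re_inner_cfc_diagOperator {ι : Type*} [Fintype ι] {e : ι → H} (he : Orthonormal ℂ e)
    {f : ℝ → ℝ} (hf : ContinuousOn f (Set.Ioi 0)) {x : ι → ℝ} (hx : ∀ i, 0 < x i) (c : ι → ℝ) :
    (inner ℂ (∑ i, (c i : ℂ) • e i)
      (cfc f (diagOperator e x) (∑ i, (c i : ℂ) • e i))).re = ∑ i, c i ^ 2 * f (x i) := by
  classical
  have h : ∀ i, cfc f (diagOperator e x) (e i) = (f (x i) : ℂ) • e i := fun i =>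
    cfc_apply_of_eigenvector hf (diagOperator_nonneg he hx) (isUnit_diagOperator he hx)
      (diagOperator_apply_self he x i)
  simp only [map_sum, map_smul, h, smul_smul, ← Complex.ofReal_mul]
  rw [he.inner_sum, Complex.re_sum]
  refine Finset.sum_congr rfl fun i _ => ?_
  rw [Complex.conj_ofReal, ← Complex.ofReal_mul, Complex.ofReal_re]
  ring

open Polynomial in
/-- **Jensen's inequality for quadratures.** If a discrete measure on `card ι` points and
a quadrature formula with `card κ` nodes have the same moments of order below `2 card κ`, then an
operator concave function has a larger integral against the latter, also after multiplying with
the square of a polynomial of degree less than `card κ`. -/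
theorem IsOperatorConcaveOn.sum_le_sum_of_moments_eq {ι κ : Type*} [Fintype ι] [Fintype κ]
    {f : ℝ → ℝ} (hfc : ContinuousOn f (Set.Ioi 0)) (hf : IsOperatorConcaveOn H f)
    {e : ι → H} (he : Orthonormal ℂ e) {x a : ι → ℝ} {y b : κ → ℝ}
    (hx : ∀ i, 0 < x i) (ha : ∀ i, 0 ≤ a i) (hy : Function.Injective y)
    (hm : ∀ p : ℝ[X], p.natDegree < 2 * Fintype.card κ →
      ∑ i, a i * p.eval (x i) = ∑ j, b j * p.eval (y j))
    {q : ℝ[X]} (hq : q.natDegree < Fintype.card κ) :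
    ∑ i, a i * (q.eval (x i) ^ 2 * f (x i)) ≤ ∑ j, b j * (q.eval (y j) ^ 2 * f (y j)) := by
  classical
  set J : ℝ[X] → H := fun p => ∑ i, ((√(a i) * p.eval (x i) : ℝ) : ℂ) • e i with hJ
  have hinner : ∀ p p' : ℝ[X], p.natDegree + p'.natDegree < 2 * Fintype.card κ →
      inner ℂ (J p) (J p') = ((∑ j, b j * (p.eval (y j) * p'.eval (y j)) : ℝ) : ℂ) := by
    intro p p' hpp
    have := hm (p * p') (natDegree_mul_le.trans_lt hpp)
    simp only [eval_mul] at this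
    rw [← this, hJ, he.inner_sum, Complex.ofReal_sum]
    refine Finset.sum_congr rfl fun i _ => ?_
    rw [Complex.conj_ofReal, ← Complex.ofReal_mul]
    congr 1
    rw [mul_mul_mul_comm, Real.mul_self_sqrt (ha i)]
  set ℓ : κ → ℝ[X] := Lagrange.basis Finset.univ y with hℓ
  have hinj : Set.InjOn y (Finset.univ : Finset κ) := hy.injOn
  have hℓdeg : ∀ j, (ℓ j).natDegree < Fintype.card κ := fun j => by
    rw [hℓ, Lagrange.natDegree_basis hinj (Finset.mem_univ j), Finset.card_univ]
    exact Nat.sub_lt (Fintype.card_pos_iff.mpr ⟨j⟩) one_pos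
  have hℓeval : ∀ i j, (ℓ i).eval (y j) = if i = j then 1 else 0 := by
    intro i j
    split_ifs with h
    · rw [h]; exact Lagrange.eval_basis_self hinj (Finset.mem_univ j)
    · exact Lagrange.eval_basis_of_ne h (Finset.mem_univ j)
  have hJq : J q = ∑ j, ((q.eval (y j) : ℝ) : ℂ) • J (ℓ j) := by
    have hq' : q = Lagrange.interpolate Finset.univ y fun j => q.eval (y j) :=
      Lagrange.eq_interpolate hinj
        (lt_of_le_of_lt degree_le_natDegree (by rw [Finset.card_univ]; exact_mod_cast hq))
    have hqe : ∀ t, q.eval t = ∑ j, q.eval (y j) * (ℓ j).eval t := by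
      intro t
      conv_lhs => rw [hq']
      simp [Lagrange.interpolate_apply, eval_finsetSum, hℓ]
    simp only [hJ, Finset.smul_sum]
    rw [Finset.sum_comm]
    refine Finset.sum_congr rfl fun i _ => ?_
    rw [hqe]
    simp only [smul_smul, ← Finset.sum_smul, ← Complex.ofReal_mul, ← Complex.ofReal_sum]
    congr 2
    rw [Finset.mul_sum]
    exact Finset.sum_congr rfl fun j _ => by ring
  set K : Submodule ℂ H := Submodule.span ℂ (Set.range fun j => J (ℓ j)) with hK
  have hKf : FiniteDimensional ℂ K := FiniteDimensional.span_of_finite ℂ (Set.finite_range _)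
  set e' : ι → H := fun i => K.reflection (e i) with he'
  have heo : Orthonormal ℂ e' := he.comp_linearIsometryEquiv K.reflection
  have hmemK : ∀ j, J (ℓ j) ∈ K := fun j => Submodule.subset_span ⟨j, rfl⟩
  have hJqK : J q ∈ K := by
    rw [hJq]; exact K.sum_mem fun j _ => K.smul_mem _ (hmemK j)
  have hrefl : ∀ p, K.reflection (J p) = ∑ i, ((√(a i) * p.eval (x i) : ℝ) : ℂ) • e' i := by
    intro p
    simp only [hJ, map_sum, map_smul, he']
  set T := diagOperator e x with hT
  set T' := diagOperator e' x with hT'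
  have hTJ : ∀ p, T (J p) = J (X * p) := by
    intro p
    simp only [hJ, map_sum, map_smul, hT, diagOperator_apply_self he, smul_smul]
    refine Finset.sum_congr rfl fun i _ => ?_
    rw [← Complex.ofReal_mul, eval_mul, eval_X]
    congr 2; ring
  have hTJ' : ∀ p, T' (K.reflection (J p)) = K.reflection (J (X * p)) := by
    intro p
    simp only [hrefl, map_sum, map_smul, hT', diagOperator_apply_self heo, smul_smul]
    refine Finset.sum_congr rfl fun i _ => ?_
    rw [← Complex.ofReal_mul, eval_mul, eval_X]
    congr 2; ring
  have hsplit : ∀ j, J (X * ℓ j) = (y j : ℂ) • J (ℓ j) + J ((X - C (y j)) * ℓ j) := by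
    intro j
    simp only [hJ, Finset.smul_sum, ← Finset.sum_add_distrib, smul_smul, ← add_smul]
    refine Finset.sum_congr rfl fun i _ => ?_
    rw [← Complex.ofReal_mul, ← Complex.ofReal_add]
    congr 2
    simp only [eval_mul, eval_sub, eval_X, eval_C]
    ring
  have hperp : ∀ j, J ((X - C (y j)) * ℓ j) ∈ Kᗮ := by
    intro j
    rw [hK, Submodule.mem_orthogonal]
    intro u hu
    induction hu using Submodule.span_induction with
    | mem u hu =>
      obtain ⟨k, rfl⟩ := hu
      rw [hinner]
      · rw [Complex.ofReal_eq_zero]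
        refine Finset.sum_eq_zero fun i _ => ?_
        rw [eval_mul, hℓeval j]
        split_ifs with h
        · simp [h]
        · simp
      · have h1 := hℓdeg k
        have h2 := hℓdeg j
        have h3 : ((X - C (y j)) * ℓ j).natDegree ≤ 1 + (ℓ j).natDegree :=
          natDegree_mul_le.trans (by rw [natDegree_X_sub_C])
        omega
    | zero => simp
    | add u v _ _ hu hv => rw [inner_add_left, hu, hv, add_zero]
    | smul c u _ hu => rw [inner_smul_left, hu, mul_zero]
  have hTs : IsStrictlyPositive T :=
    (isUnit_diagOperator he hx).isStrictlyPositive (diagOperator_nonneg he hx)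
  have hTs' : IsStrictlyPositive T' :=
    (isUnit_diagOperator heo hx).isStrictlyPositive (diagOperator_nonneg heo hx)
  have hhalf : (1 / 2 : ℝ) ∈ Set.Icc (0 : ℝ) 1 := by constructor <;> norm_num
  set R := (1 / 2 : ℝ) • T + (1 - 1 / 2 : ℝ) • T' with hR
  have hRs : IsStrictlyPositive R :=
    (hTs.smul (by norm_num)).add_nonneg (smul_nonneg (by norm_num) hTs'.nonneg)
  have hRJ : ∀ j, R (J (ℓ j)) = (y j : ℂ) • J (ℓ j) := by
    intro j
    have h1 : K.reflection (J (ℓ j)) = J (ℓ j) :=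
      Submodule.reflection_mem_subspace_eq_self (hmemK j)
    have h2 : T' (J (ℓ j)) = (y j : ℂ) • J (ℓ j) - J ((X - C (y j)) * ℓ j) := by
      conv_lhs => rw [← h1]
      rw [hTJ', hsplit, map_add, map_smul, h1,
        Submodule.reflection_mem_subspace_orthogonalComplement_eq_neg (hperp j)]
      abel
    rw [hR, add_apply, smul_apply, smul_apply, h2, hTJ, hsplit]
    module
  have hmain := re_inner_le_of_le (hf.smul_cfc_add_le hTs.nonneg hTs.isUnit hTs'.nonneg
    hTs'.isUnit hhalf) (J q)
  have hT1 : (inner ℂ (J q) (cfc f T (J q))).re = ∑ i, a i * (q.eval (x i) ^ 2 * f (x i)) := by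
    rw [hJ, hT, re_inner_cfc_diagOperator he hfc hx]
    refine Finset.sum_congr rfl fun i _ => ?_
    rw [mul_pow, Real.sq_sqrt (ha i), mul_assoc]
  have hT2 : (inner ℂ (J q) (cfc f T' (J q))).re = ∑ i, a i * (q.eval (x i) ^ 2 * f (x i)) := by
    rw [← Submodule.reflection_mem_subspace_eq_self hJqK, hrefl, hT',
      re_inner_cfc_diagOperator heo hfc hx]
    refine Finset.sum_congr rfl fun i _ => ?_
    rw [mul_pow, Real.sq_sqrt (ha i), mul_assoc]
  have hR1 : (inner ℂ (J q) (cfc f R (J q))).re = ∑ j, b j * (q.eval (y j) ^ 2 * f (y j)) := by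
    have h1 : cfc f R (J q) = ∑ j, ((q.eval (y j) * f (y j) : ℝ) : ℂ) • J (ℓ j) := by
      rw [hJq, map_sum]
      refine Finset.sum_congr rfl fun j _ => ?_
      rw [map_smul, cfc_apply_of_eigenvector hfc hRs.nonneg hRs.isUnit (hRJ j), smul_smul,
        ← Complex.ofReal_mul]
    rw [h1, inner_sum, Complex.re_sum]
    refine Finset.sum_congr rfl fun j _ => ?_
    have h2 := hℓdeg j
    rw [inner_smul_right, hinner _ _ (by omega), ← Complex.ofReal_mul, Complex.ofReal_re]
    simp only [hℓeval]
    simp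
    ring
  rw [add_apply, smul_apply, smul_apply, inner_add_right, ← Complex.coe_smul, ← Complex.coe_smul,
    inner_smul_right, inner_smul_right, Complex.add_re, ← hR, hR1, Complex.re_ofReal_mul,
    Complex.re_ofReal_mul, hT1, hT2] at hmain
  linarith

/-- The derivative at `z` of the monic polynomial with the simple roots `S`, for `z ∈ S`. -/
noncomputable def nodeProd (S : Finset ℝ) (z : ℝ) : ℝ := ∏ z' ∈ S.erase z, (z - z')

theorem nodeProd_ne_zero (S : Finset ℝ) (z : ℝ) : nodeProd S z ≠ 0 :=
  Finset.prod_ne_zero_iff.mpr fun _ h => sub_ne_zero.mpr (Finset.ne_of_mem_erase h).symm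

theorem nodeProd_insert_of_mem {S : Finset ℝ} {z x : ℝ} (hx : x ∉ S) (hz : z ∈ S) :
    nodeProd (insert x S) z = (z - x) * nodeProd S z := by
  have hne : x ≠ z := fun h => hx (h ▸ hz)
  rw [nodeProd, Finset.erase_insert_of_ne hne, Finset.prod_insert, nodeProd]
  exact fun h => hx (Finset.mem_of_mem_erase h)

theorem nodeProd_insert_self {S : Finset ℝ} {x : ℝ} (hx : x ∉ S) :
    nodeProd (insert x S) x = ∏ z ∈ S, (x - z) := by
  rw [nodeProd, Finset.erase_insert hx]

/-- The signs of the derivative at consecutive simple roots alternate. -/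
theorem card_filter_nodeProd (S : Finset ℝ) :
    (S.filter fun z => 0 < nodeProd S z).card = (S.card + 1) / 2 ∧
      (S.filter fun z => nodeProd S z < 0).card = S.card / 2 := by
  classical
  induction S using Finset.induction_on_max with
  | empty => simp
  | insert x S hx ih =>
    have hxS : x ∉ S := fun h => (hx x h).false
    have hpos : 0 < nodeProd (insert x S) x := by
      rw [nodeProd_insert_self hxS]
      exact Finset.prod_pos fun z hz => sub_pos.mpr (hx z hz)
    have h1 : (S.filter fun z => 0 < nodeProd (insert x S) z)
        = S.filter fun z => nodeProd S z < 0 := by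
      refine Finset.filter_congr fun z hz => ?_
      rw [nodeProd_insert_of_mem hxS hz]
      have := sub_neg.mpr (hx z hz)
      exact ⟨fun h => (neg_iff_neg_of_mul_pos h).mp this, fun h => mul_pos_of_neg_of_neg this h⟩
    have h2 : (S.filter fun z => nodeProd (insert x S) z < 0)
        = S.filter fun z => 0 < nodeProd S z := by
      refine Finset.filter_congr fun z hz => ?_
      rw [nodeProd_insert_of_mem hxS hz]
      have := sub_neg.mpr (hx z hz)
      exact ⟨fun h => by nlinarith, fun h => mul_neg_of_neg_of_pos this h⟩
    rw [Finset.filter_insert, Finset.filter_insert, if_pos hpos, if_neg hpos.not_gt, h1, h2,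
      Finset.card_insert_of_notMem (by simp [hxS]), Finset.card_insert_of_notMem hxS, ih.1, ih.2]
    omega

theorem sum_eq_sum_filter_nodeProd (S : Finset ℝ) (g : ℝ → ℝ) :
    ∑ z ∈ S, g z = ∑ z ∈ S.filter (fun z => 0 < nodeProd S z), g z +
      ∑ z ∈ S.filter (fun z => nodeProd S z < 0), g z := by
  rw [← Finset.sum_filter_add_sum_filter_not S fun z => 0 < nodeProd S z]
  congr 2
  refine Finset.filter_congr fun z _ => ?_
  rw [not_lt]
  exact ⟨fun h => lt_of_le_of_ne h (nodeProd_ne_zero S z), le_of_lt⟩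

open Polynomial in
theorem sum_eval_div_nodeProd_eq_zero {S : Finset ℝ} {p : ℝ[X]} (hp : p.natDegree + 1 < S.card) :
    ∑ z ∈ S, p.eval z / nodeProd S z = 0 := by
  have h := Lagrange.coeff_eq_sum (s := S) (v := fun z : ℝ => z) (Set.injOn_id _) (P := p)
    (lt_of_le_of_lt degree_le_natDegree (by exact_mod_cast (by omega)))
  rw [coeff_eq_zero_of_natDegree_lt (by omega)] at h
  exact h.symm

open Polynomial in
theorem IsOperatorConcaveOn.sum_div_nodeProd_nonpos {d : ℕ} {e : Fin d → H}
    (he : Orthonormal ℂ e) {f : ℝ → ℝ} (hfc : ContinuousOn f (Set.Ioi 0))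
    (hf : IsOperatorConcaveOn H f) {S : Finset ℝ} (hS : ∀ z ∈ S, 0 < z) {m : ℕ}
    (hm : S.card = 2 * m + 1) (hmd : m + 1 ≤ d) {q : ℝ[X]} (hq : q.natDegree + 1 ≤ m) :
    ∑ z ∈ S, q.eval z ^ 2 * f z / nodeProd S z ≤ 0 := by
  obtain ⟨h1, h2⟩ := card_filter_nodeProd S
  set P := S.filter fun z => 0 < nodeProd S z with hP
  set N := S.filter fun z => nodeProd S z < 0 with hN
  have hc : Fintype.card N = m := by rw [Fintype.card_coe, h2]; omega
  let φ : P ↪ Fin d := (P.equivFinOfCardEq (n := m + 1) (by rw [h1]; omega)).toEmbedding.trans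
    (Fin.castLEEmb hmd)
  have key := hf.sum_le_sum_of_moments_eq hfc (he.comp φ φ.injective)
    (x := fun i : P => (i : ℝ)) (a := fun i : P => (nodeProd S i)⁻¹)
    (y := fun i : N => (i : ℝ)) (b := fun i : N => -(nodeProd S i)⁻¹)
    (fun i => hS i (Finset.mem_filter.mp i.2).1)
    (fun i => (inv_pos.mpr (Finset.mem_filter.mp i.2).2).le)
    Subtype.val_injective
    (by
      intro p hp
      have h0 := sum_eval_div_nodeProd_eq_zero (S := S) (p := p) (by omega)
      rw [sum_eq_sum_filter_nodeProd] at h0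
      rw [Finset.sum_coe_sort P fun i => (nodeProd S i)⁻¹ * p.eval i,
        Finset.sum_coe_sort N fun i => -(nodeProd S i)⁻¹ * p.eval i]
      simp only [div_eq_inv_mul] at h0
      simp only [neg_mul, Finset.sum_neg_distrib]
      linarith) (q := q) (by omega)
  rw [Finset.sum_coe_sort P fun i => (nodeProd S i)⁻¹ * (q.eval i ^ 2 * f i),
    Finset.sum_coe_sort N fun i => -(nodeProd S i)⁻¹ * (q.eval i ^ 2 * f i)] at key
  rw [sum_eq_sum_filter_nodeProd]
  simp only [div_eq_inv_mul]
  simp only [neg_mul, Finset.sum_neg_distrib] at key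
  linarith

open Polynomial Filter Topology in
theorem IsOperatorConcaveOn.sum_div_nodeProd_nonneg {d : ℕ} {e : Fin d → H}
    (he : Orthonormal ℂ e) {f : ℝ → ℝ} (hfc : ContinuousOn f (Set.Ioi 0))
    (hfpos : ∀ t ∈ Set.Ioi (0 : ℝ), 0 < f t)
    (hf : IsOperatorConcaveOn H f) {S : Finset ℝ} (hS : ∀ z ∈ S, 0 < z) {m : ℕ}
    (hm : S.card = 2 * m) (hmd : m + 1 ≤ d) {q : ℝ[X]} (hq : q.natDegree + 1 ≤ m) :
    0 ≤ ∑ z ∈ S, q.eval z ^ 2 * f z / nodeProd S z := by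
  have hlim : Tendsto (fun L : ℝ => ∑ z ∈ S, q.eval z ^ 2 * f z / nodeProd S z * (1 + z / (L - z)))
      atTop (𝓝 (∑ z ∈ S, q.eval z ^ 2 * f z / nodeProd S z * (1 + 0))) := by
    refine tendsto_finsetSum _ fun z _ => ?_
    refine tendsto_const_nhds.mul (tendsto_const_nhds.add ?_)
    exact tendsto_const_nhds.div_atTop (tendsto_atTop_add_const_right _ _ tendsto_id)
  simp only [add_zero, mul_one] at hlim
  refine ge_of_tendsto hlim ?_
  have hev : ∀ᶠ L : ℝ in atTop, ∀ z ∈ S, z < L := by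
    rw [Filter.eventually_all_finset]
    exact fun z _ => eventually_gt_atTop z
  filter_upwards [hev, eventually_gt_atTop 0] with L hL hL0
  have hLS : L ∉ S := fun h => (hL L h).false
  have key := hf.sum_div_nodeProd_nonpos he hfc (S := insert L S)
    (by simpa [hL0] using hS) (m := m) (by rw [Finset.card_insert_of_notMem hLS, hm]) hmd hq
  rw [Finset.sum_insert hLS, nodeProd_insert_self hLS] at key
  have hpos : 0 ≤ q.eval L ^ 2 * f L / ∏ z ∈ S, (L - z) :=
    div_nonneg (mul_nonneg (sq_nonneg _) (hfpos L hL0).le)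
      (Finset.prod_nonneg fun z hz => (sub_pos.mpr (hL z hz)).le)
  have hsum : ∑ z ∈ S, q.eval z ^ 2 * f z / nodeProd S z * (1 + z / (L - z))
      = -L * ∑ z ∈ S, q.eval z ^ 2 * f z / nodeProd (insert L S) z := by
    rw [Finset.mul_sum]
    refine Finset.sum_congr rfl fun z hz => ?_
    rw [nodeProd_insert_of_mem hLS hz]
    have h1 : L - z ≠ 0 := (sub_pos.mpr (hL z hz)).ne'
    have h2 : z - L ≠ 0 := (sub_neg.mpr (hL z hz)).ne
    have h3 := nodeProd_ne_zero S z
    field_simp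
    ring
  rw [hsum]
  nlinarith

open Polynomial in
/-- Generalized divided differences of an operator concave function alternate in sign. -/
theorem IsOperatorConcaveOn.neg_one_pow_mul_sum_div_nodeProd_nonneg {d : ℕ} {e : Fin d → H}
    (he : Orthonormal ℂ e) {f : ℝ → ℝ} (hfc : ContinuousOn f (Set.Ioi 0))
    (hfpos : ∀ t ∈ Set.Ioi (0 : ℝ), 0 < f t)
    (hf : IsOperatorConcaveOn H f) {S : Finset ℝ} (hS : ∀ z ∈ S, 0 < z)
    (hd : S.card / 2 + 1 ≤ d) {q : ℝ[X]} (hq : 2 * q.natDegree + 2 ≤ S.card) :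
    0 ≤ (-1) ^ S.card * ∑ z ∈ S, q.eval z ^ 2 * f z / nodeProd S z := by
  rcases Nat.even_or_odd' S.card with ⟨m, hm | hm⟩
  · have := hf.sum_div_nodeProd_nonneg he hfc hfpos hS hm (by omega) (q := q) (by omega)
    simpa [hm, pow_mul] using this
  · have := hf.sum_div_nodeProd_nonpos he hfc hS hm (by omega) (q := q) (by omega)
    rw [hm, pow_succ, pow_mul]
    simpa using this

open Polynomial Filter Topology in
/-- The functional `∑ p(-t) f(t) / (t ∏ (t' - t))` is nonnegative on polynomials positive on
`[0, ∞)`. -/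
theorem IsOperatorConcaveOn.sum_eval_neg_nonneg {d : ℕ} {e : Fin d → H}
    (he : Orthonormal ℂ e) {f : ℝ → ℝ} (hfc : ContinuousOn f (Set.Ioi 0))
    (hfpos : ∀ t ∈ Set.Ioi (0 : ℝ), 0 < f t)
    (hf : IsOperatorConcaveOn H f) {S : Finset ℝ} (hS : ∀ z ∈ S, 0 < z) (hd : S.card ≤ d)
    {p : ℝ[X]} (hpdeg : p.natDegree + 1 ≤ S.card) (hp : ∀ s : ℝ, 0 ≤ s → 0 < p.eval s) :
    0 ≤ (-1) ^ (S.card + 1) * ∑ z ∈ S, p.eval (-z) * f z / (z * nodeProd S z) := by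
  have hcomp : ∀ q : ℝ[X], (q.comp (-X)).natDegree ≤ q.natDegree := fun q => by
    simpa using natDegree_comp_le (p := q) (q := -X)
  have hce : ∀ (q : ℝ[X]) (z : ℝ), (q.comp (-X)).eval z = q.eval (-z) := fun q z => by simp
  refine positive_halfLine_induction (n := S.card - 1)
    (P := fun p => 0 ≤ (-1) ^ (S.card + 1) * ∑ z ∈ S, p.eval (-z) * f z / (z * nodeProd S z))
    ?_ ?_ ?_ (by omega) hp
  · intro p q hp hq
    have := add_nonneg hp hq
    rw [← mul_add, ← Finset.sum_add_distrib] at this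
    simpa only [eval_add, add_mul, add_div] using this
  · intro q hq
    rcases Nat.lt_or_ge S.card 2 with hc | hc
    · obtain ⟨t, rfl⟩ := Finset.card_eq_one.mp (by omega : S.card = 1)
      have ht : 0 < t := hS t (by simp)
      have := hfpos t ht
      simp only [Finset.card_singleton, Finset.sum_singleton, nodeProd, Finset.erase_singleton,
        Finset.prod_empty, eval_pow]
      norm_num
      positivity
    · have hlim : Tendsto (fun ε : ℝ => (-1) ^ (S.card + 1) *
          ∑ z ∈ S, (q ^ 2).eval (-z) * f z / ((z - ε) * nodeProd S z)) (𝓝[>] 0)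
          (𝓝 ((-1) ^ (S.card + 1) *
            ∑ z ∈ S, (q ^ 2).eval (-z) * f z / ((z - 0) * nodeProd S z))) := by
        refine tendsto_nhdsWithin_of_tendsto_nhds ?_
        refine tendsto_const_nhds.mul (tendsto_finsetSum _ fun z hz => ?_)
        refine tendsto_const_nhds.div ((tendsto_const_nhds.sub tendsto_id).mul
          tendsto_const_nhds) ?_
        rw [sub_zero]
        exact mul_ne_zero (hS z hz).ne' (nodeProd_ne_zero S z)
      simp only [sub_zero] at hlim
      refine ge_of_tendsto hlim ?_
      have hev : ∀ᶠ ε : ℝ in 𝓝[>] 0, ∀ z ∈ S, ε < z := by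
        rw [Filter.eventually_all_finset]
        exact fun z hz => tendsto_nhdsWithin_of_tendsto_nhds tendsto_id (Iio_mem_nhds (hS z hz))
      filter_upwards [hev, self_mem_nhdsWithin] with ε hε hε0
      have hεS : ε ∉ S := fun h => (hε ε h).false
      have hε1 : 0 < ε := hε0
      have key := hf.neg_one_pow_mul_sum_div_nodeProd_nonneg he hfc hfpos (S := insert ε S)
        (by simpa [hε1] using hS) (by rw [Finset.card_insert_of_notMem hεS]; omega)
        (q := q.comp (-X))
        (by have := hcomp q; rw [Finset.card_insert_of_notMem hεS]; omega)
      rw [Finset.card_insert_of_notMem hεS, Finset.sum_insert hεS, nodeProd_insert_self hεS,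
        mul_add] at key
      have hneg : (-1) ^ (S.card + 1) * ((q.comp (-X)).eval ε ^ 2 * f ε / ∏ z ∈ S, (ε - z))
          ≤ 0 := by
        have h1 : ∏ z ∈ S, (ε - z) = (-1) ^ S.card * ∏ z ∈ S, (z - ε) := by
          rw [← Finset.prod_const, ← Finset.prod_mul_distrib]
          exact Finset.prod_congr rfl fun z _ => by ring
        have h2 : 0 < ∏ z ∈ S, (z - ε) := Finset.prod_pos fun z hz => sub_pos.mpr (hε z hz)
        have h3 := hfpos ε hε1
        rw [h1]
        rcases neg_one_pow_eq_or ℝ S.card with h | h <;> rw [pow_succ, h] <;>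
        · simp only [one_mul, neg_mul, mul_neg, mul_one, neg_neg, div_neg]
          rw [neg_nonpos]
          positivity
      have hsum : ∑ z ∈ S, (q ^ 2).eval (-z) * f z / ((z - ε) * nodeProd S z)
          = ∑ z ∈ S, (q.comp (-X)).eval z ^ 2 * f z / nodeProd (insert ε S) z := by
        refine Finset.sum_congr rfl fun z hz => ?_
        rw [nodeProd_insert_of_mem hεS hz, hce, eval_pow]
      rw [hsum]
      linarith
  · intro q hq
    have key := hf.neg_one_pow_mul_sum_div_nodeProd_nonneg he hfc hfpos hS (by omega)
      (q := q.comp (-X)) (by have := hcomp q; omega)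
    have hsum : ∑ z ∈ S, (X * q ^ 2).eval (-z) * f z / (z * nodeProd S z)
        = -∑ z ∈ S, (q.comp (-X)).eval z ^ 2 * f z / nodeProd S z := by
      rw [← Finset.sum_neg_distrib]
      refine Finset.sum_congr rfl fun z hz => ?_
      have h1 := (hS z hz).ne'
      have h2 := nodeProd_ne_zero S z
      rw [hce, eval_mul, eval_pow, eval_X]
      field_simp
    rw [hsum, pow_succ]
    linarith

open Polynomial in
/-- The elementary functions `t ↦ t / ((1 - u) t + u t₁)` interpolate, up to convex combinations,
an operator concave function on finitely many points. -/
theorem IsOperatorConcaveOn.exists_interpolation {d : ℕ} {e : Fin d → H}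
    (he : Orthonormal ℂ e) {f : ℝ → ℝ} (hfc : ContinuousOn f (Set.Ioi 0))
    (hfpos : ∀ t ∈ Set.Ioi (0 : ℝ), 0 < f t)
    (hf : IsOperatorConcaveOn H f) {S : Finset ℝ} (hS : ∀ z ∈ S, 0 < z) (hd : S.card ≤ d)
    {t₁ : ℝ} (ht₁ : t₁ ∈ S) :
    ∃ (κ : Type) (_ : Fintype κ) (w u : κ → ℝ), (∀ j, 0 ≤ w j) ∧ ∑ j, w j = 1 ∧
      (∀ j, u j ∈ Set.Icc (0 : ℝ) 1) ∧
      ∀ t ∈ S, f t = f t₁ * ∑ j, w j * (t / ((1 - u j) * t + u j * t₁)) := by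
  have ht₁0 := hS t₁ ht₁
  have hft₁ : 0 < f t₁ := hfpos t₁ ht₁0
  have hden : ∀ t ∈ S, ∀ u ∈ Set.Icc (0 : ℝ) 1, 0 < (1 - u) * t + u * t₁ := by
    intro t ht u hu
    have := hS t ht
    rcases hu.1.eq_or_lt with h | h
    · rw [← h]; simpa using this
    · have := mul_nonneg (sub_nonneg.mpr hu.2) this.le
      have := mul_pos h ht₁0
      linarith
  set γ : ℝ → S → ℝ := fun u t => t / ((1 - u) * t + u * t₁) with hγ
  have hγc : ContinuousOn γ (Set.Icc 0 1) := by
    refine continuousOn_pi.mpr fun t => ContinuousOn.div (by fun_prop) (by fun_prop) ?_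
    exact fun u hu => (hden t t.2 u hu).ne'
  have hcomp : IsCompact (convexHull ℝ (γ '' Set.Icc 0 1)) :=
    (isCompact_Icc.image_of_continuousOn hγc).convexHull_of_finiteDimensional
  by_cases hF : (fun t : S => f t / f t₁) ∈ convexHull ℝ (γ '' Set.Icc 0 1)
  · rw [mem_convexHull_iff_exists_fintype] at hF
    obtain ⟨κ, hκ, w, z, hw, hw1, hz, hsum⟩ := hF
    choose u hu huz using hz
    refine ⟨κ, hκ, w, u, hw, hw1, hu, fun t ht => ?_⟩
    have h := congrFun hsum ⟨t, ht⟩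
    simp only [Finset.sum_apply, Pi.smul_apply, ← huz, hγ, smul_eq_mul] at h
    rw [h]
    field_simp
  · exfalso
    obtain ⟨l, u₀, hl, hu₀⟩ := geometric_hahn_banach_point_closed (convex_convexHull ℝ _)
      hcomp.isClosed hF
    classical
    set c : ℝ → ℝ := fun t => (if h : t ∈ S then l (Pi.single ⟨t, h⟩ 1) else 0) -
      if t = t₁ then u₀ else 0 with hc
    have hcl : ∀ v : ℝ → ℝ, ∑ t ∈ S, c t * v t = l (fun t : S => v t) - u₀ * v t₁ := by
      intro v
      have h1 : (fun t : S => v t) = ∑ t : S, v t • (Pi.single t 1 : S → ℝ) := by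
        ext t
        simp [Finset.sum_apply, Pi.single_apply]
      rw [h1, map_sum]
      simp only [hc, sub_mul, Finset.sum_sub_distrib, ite_mul, zero_mul]
      rw [Finset.sum_ite_eq' S t₁, if_pos ht₁, ← Finset.sum_coe_sort S]
      congr 1
      refine Finset.sum_congr rfl fun t _ => ?_
      simp [mul_comm]
    have hneg : ∑ t ∈ S, c t * f t < 0 := by
      have h1 := hcl fun t => f t / f t₁
      rw [div_self hft₁.ne', mul_one] at h1
      have h2 : ∑ t ∈ S, c t * f t = f t₁ * ∑ t ∈ S, c t * (f t / f t₁) := by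
        rw [Finset.mul_sum]
        refine Finset.sum_congr rfl fun t _ => ?_
        field_simp
      rw [h2, h1]
      exact mul_neg_of_pos_of_neg hft₁ (by linarith)
    set p : ℝ[X] := ∑ t ∈ S, C (c t * t) * ∏ t' ∈ S.erase t, (X + C t') with hp
    have hcard : 0 < S.card := Finset.card_pos.mpr ⟨t₁, ht₁⟩
    have hpdeg : p.natDegree + 1 ≤ S.card := by
      have : p.natDegree ≤ S.card - 1 := by
        refine natDegree_sum_le_of_forall_le _ _ fun t ht => ?_
        refine (natDegree_C_mul_le _ _).trans ((natDegree_prod_le _ _).trans ?_)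
        simp [Finset.card_erase_of_mem ht]
      omega
    have hppos : ∀ s : ℝ, 0 ≤ s → 0 < p.eval s := by
      intro s hs
      have hst : 0 < s + t₁ := by linarith
      have hu : s / (s + t₁) ∈ Set.Icc (0 : ℝ) 1 :=
        ⟨by positivity, (div_le_one hst).mpr (by linarith)⟩
      have h1 := hcl fun t => t / ((1 - s / (s + t₁)) * t + s / (s + t₁) * t₁)
      have h2 := hu₀ _ (subset_convexHull ℝ _ (Set.mem_image_of_mem γ hu))
      have h3 : p.eval s = t₁ / (s + t₁) * (∏ t ∈ S, (s + t)) *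
          ∑ t ∈ S, c t * (t / ((1 - s / (s + t₁)) * t + s / (s + t₁) * t₁)) := by
        rw [hp, eval_finsetSum, Finset.mul_sum]
        refine Finset.sum_congr rfl fun t ht => ?_
        have hsz := hS t ht
        rw [eval_mul, eval_C, eval_prod, ← Finset.mul_prod_erase S _ ht]
        simp only [eval_add, eval_X, eval_C]
        have h4 : (1 - s / (s + t₁)) * t + s / (s + t₁) * t₁ = t₁ * (s + t) / (s + t₁) := by
          field_simp
          ring
        have h5 : s + t ≠ 0 := by positivity
        rw [h4]
        field_simp
      rw [h3, h1]
      refine mul_pos (mul_pos (by positivity)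
        (Finset.prod_pos fun t ht => by have := hS t ht; positivity)) ?_
      have h6 : t₁ / ((1 - s / (s + t₁)) * t₁ + s / (s + t₁) * t₁) = 1 := by
        rw [← add_mul, sub_add_cancel, one_mul, div_self ht₁0.ne']
      rw [h6, mul_one]
      exact sub_pos.mpr h2
    have key := hf.sum_eval_neg_nonneg he hfc hfpos hS hd hpdeg hppos
    have hsum : (-1) ^ (S.card + 1) * ∑ z ∈ S, p.eval (-z) * f z / (z * nodeProd S z)
        = ∑ t ∈ S, c t * f t := by
      rw [Finset.mul_sum]
      refine Finset.sum_congr rfl fun z hz => ?_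
      have h1 : p.eval (-z) = c z * z * ((-1) ^ (S.card - 1) * nodeProd S z) := by
        rw [hp, eval_finsetSum, Finset.sum_eq_single_of_mem z hz]
        · rw [eval_mul, eval_C, eval_prod, nodeProd, ← Finset.card_erase_of_mem hz,
            ← Finset.prod_const, ← Finset.prod_mul_distrib]
          congr 1
          refine Finset.prod_congr rfl fun t _ => ?_
          simp
          ring
        · intro t ht htz
          rw [eval_mul, eval_prod, Finset.prod_eq_zero (Finset.mem_erase.mpr ⟨htz.symm, hz⟩)
            (by simp), mul_zero]
      have h2 := nodeProd_ne_zero S z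
      have h3 := (hS z hz).ne'
      have h4 : (-1 : ℝ) ^ (S.card + 1) = (-1) ^ (S.card - 1) := by
        rw [show S.card + 1 = S.card - 1 + 2 by omega, pow_add]
        norm_num
      have h5 : ((-1 : ℝ) ^ (S.card - 1)) * (-1) ^ (S.card - 1) = 1 := by
        rw [← mul_pow]; norm_num
      rw [h1, h4]
      field_simp
      linear_combination (c z * f z) * h5
    linarith

namespace IsUnitalPositiveMap

variable {Φ : (H →L[ℂ] H) →ₗ[ℂ] (H →L[ℂ] H)}

theorem mono (hΦ : IsUnitalPositiveMap Φ) {X Y : H →L[ℂ] H} (h : X ≤ Y) : Φ X ≤ Φ Y := by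
  have := hΦ.2 (Y - X) (sub_nonneg.mpr h)
  rwa [map_sub, sub_nonneg] at this

theorem map_real_smul (Φ : (H →L[ℂ] H) →ₗ[ℂ] (H →L[ℂ] H)) (c : ℝ) (X : H →L[ℂ] H) :
    Φ (c • X) = c • Φ X :=
  LinearMap.map_smul_of_tower Φ c X

theorem map_isStrictlyPositive (hΦ : IsUnitalPositiveMap Φ) {C : H →L[ℂ] H}
    (hC : IsStrictlyPositive C) : IsStrictlyPositive (Φ C) := by
  obtain ⟨a, b, ha, -, hab⟩ := exists_spectrum_subset_Icc hC.nonneg hC.isUnit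
  have h1 : algebraMap ℝ (H →L[ℂ] H) a ≤ C :=
    (algebraMap_le_iff_le_spectrum hC.nonneg.isSelfAdjoint).mpr fun t ht => (hab ht).1
  rw [Algebra.algebraMap_eq_smul_one] at h1
  have h2 := hΦ.mono h1
  rw [map_real_smul, hΦ.1] at h2
  exact IsStrictlyPositive.of_le (IsStrictlyPositive.smul ha isStrictlyPositive_one) h2

/-- The variance of a positive operator valued probability measure is nonnegative. -/
theorem mul_self_le_sum_of_sum_eq_one {ι : Type*} (s : Finset ι) {E : ι → H →L[ℂ] H}
    (hE : ∀ i, 0 ≤ E i) (hs0 : ∑ i ∈ s, E i = 1) (x : ι → ℝ) {T : H →L[ℂ] H}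
    (hT : ∑ i ∈ s, x i • E i = T) : T * T ≤ ∑ i ∈ s, (x i * x i) • E i := by
  have hTsa : IsSelfAdjoint T := by
    rw [← hT]
    exact isSelfAdjoint_sum s fun i _ => (IsSelfAdjoint.all (x i)).smul (hE i).isSelfAdjoint
  have hsa : ∀ c : ℝ, IsSelfAdjoint (c • (1 : H →L[ℂ] H) - T) := fun c =>
    ((IsSelfAdjoint.all c).smul (IsSelfAdjoint.one _)).sub hTsa
  have hpos := Finset.sum_nonneg fun i (_ : i ∈ s) => (hsa (x i)).conjugate_nonneg (hE i)
  have hexp : ∀ i, (x i • (1 : H →L[ℂ] H) - T) * E i * (x i • 1 - T)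
      = (x i * x i) • E i - T * (x i • E i) - (x i • E i) * T + T * E i * T := by
    intro i
    simp only [sub_mul, mul_sub, smul_mul_assoc, mul_smul_comm, one_mul, mul_one, smul_sub,
      smul_smul]
    abel
  simp only [hexp, Finset.sum_add_distrib, Finset.sum_sub_distrib, ← Finset.mul_sum,
    ← Finset.sum_mul, hs0, hT, mul_one] at hpos
  rw [sub_add_cancel] at hpos
  exact sub_nonneg.mp hpos

/-- Kadison's inequality for contractions. -/
theorem mul_self_le_of_le_one (hΦ : IsUnitalPositiveMap Φ) {Z : H →L[ℂ] H} (hZ : 0 ≤ Z)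
    (hZ1 : Z ≤ 1) : Φ Z * Φ Z ≤ Φ (Z * Z) := by
  set T := Φ Z with hT
  have hTsa : IsSelfAdjoint T := (hΦ.2 Z hZ).isSelfAdjoint
  have hsp : ∀ t ∈ spectrum ℝ Z, 0 ≤ t ∧ t ≤ 1 := fun t ht =>
    ⟨spectrum_nonneg_of_nonneg hZ ht,
      (le_algebraMap_iff_spectrum_le hZ.isSelfAdjoint).mp (by simpa using hZ1) t ht⟩
  have hfin : ∀ n : ℕ, 0 < n →
      T * T - Φ (Z * Z) ≤ (1 / (n : ℝ)) • (T - Φ (Z * Z)) := by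
    intro n hn
    set b : ℕ → H →L[ℂ] H := fun i => Polynomial.aeval Z (bernsteinPolynomial ℝ n i) with hb
    have hb0 : ∀ i, 0 ≤ Φ (b i) := by
      intro i
      refine hΦ.2 _ ?_
      simp only [hb]
      rw [← cfc_polynomial _ Z hZ.isSelfAdjoint]
      refine cfc_nonneg fun t ht => ?_
      obtain ⟨h0, h1⟩ := hsp t ht
      have : 0 ≤ 1 - t := sub_nonneg.mpr h1
      simp only [bernsteinPolynomial, Polynomial.eval_mul, Polynomial.eval_natCast,
        Polynomial.eval_pow, Polynomial.eval_X, Polynomial.eval_sub, Polynomial.eval_one]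
      positivity
    have hs0 : ∑ i ∈ Finset.range (n + 1), Φ (b i) = 1 := by
      rw [← map_sum, ← map_sum, bernsteinPolynomial.sum, map_one, hΦ.1]
    have hs1 : ∑ i ∈ Finset.range (n + 1), (i : ℝ) • Φ (b i) = (n : ℝ) • T := by
      have h := congrArg (fun p => Φ (Polynomial.aeval Z p)) (bernsteinPolynomial.sum_smul ℝ n)
      simp only [map_sum, map_nsmul, Polynomial.aeval_X] at h
      simpa only [Nat.cast_smul_eq_nsmul ℝ] using h
    have hs2 : ∑ i ∈ Finset.range (n + 1), ((i : ℝ) * i) • Φ (b i)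
        = ((n : ℝ) * (n - 1)) • Φ (Z * Z) + (n : ℝ) • T := by
      have h := congrArg (fun p => Φ (Polynomial.aeval Z p))
        (bernsteinPolynomial.sum_mul_smul ℝ n)
      simp only [map_sum, map_nsmul, map_pow, Polynomial.aeval_X] at h
      have hc : ∀ i : ℕ, ((i * (i - 1) : ℕ) : ℝ) = (i : ℝ) * (i - 1) := by
        intro i; cases i <;> simp
      simp only [← Nat.cast_smul_eq_nsmul ℝ, hc] at h
      rw [← hs1, ← pow_two, ← h, ← Finset.sum_add_distrib]
      refine Finset.sum_congr rfl fun i _ => ?_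
      rw [← add_smul]
      congr 1; ring
    have hn' : (n : ℝ) ≠ 0 := by exact_mod_cast hn.ne'
    have key := mul_self_le_sum_of_sum_eq_one (Finset.range (n + 1)) hb0 hs0
      (fun i => (n : ℝ)⁻¹ * i) (T := T)
      (by simp only [mul_smul, ← Finset.smul_sum, hs1]; rw [inv_smul_smul₀ hn'])
    have e : ∀ i : ℕ, (n : ℝ)⁻¹ * i * ((n : ℝ)⁻¹ * i) = ((n : ℝ)⁻¹ * (n : ℝ)⁻¹) * (i * i) :=
      fun i => by ring
    simp only [e, mul_smul _ ((_ : ℝ) * _), ← Finset.smul_sum, hs2] at key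
    rw [smul_add, smul_smul, smul_smul] at key
    have e1 : (n : ℝ)⁻¹ * (n : ℝ)⁻¹ * (n * (n - 1)) = 1 - 1 / n := by field_simp
    have e2 : (n : ℝ)⁻¹ * (n : ℝ)⁻¹ * n = 1 / n := by field_simp
    rw [e1, e2] at key
    rw [sub_le_iff_le_add]
    refine key.trans (le_of_eq ?_)
    module
  have hlim : Filter.Tendsto (fun n : ℕ => (1 / (n : ℝ)) • (T - Φ (Z * Z))) Filter.atTop
      (nhds ((0 : ℝ) • (T - Φ (Z * Z)))) :=
    tendsto_one_div_atTop_nhds_zero_nat.smul_const _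
  rw [zero_smul] at hlim
  have := ge_of_tendsto hlim ((Filter.eventually_gt_atTop 0).mono hfin)
  exact sub_nonpos.mp this

/-- **Kadison's inequality** for positive operators. -/
theorem mul_self_le (hΦ : IsUnitalPositiveMap Φ) {X : H →L[ℂ] H} (hX : 0 ≤ X) :
    Φ X * Φ X ≤ Φ (X * X) := by
  set c : ℝ := ‖X‖ + 1 with hc
  have hc0 : 0 < c := by positivity
  have h1 : c⁻¹ • X ≤ 1 := by
    have : X ≤ c • 1 := by
      have h := IsSelfAdjoint.le_algebraMap_norm_self hX.isSelfAdjoint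
      refine h.trans ?_
      rw [Algebra.algebraMap_eq_smul_one]
      exact smul_le_smul_of_nonneg_right (by rw [hc]; linarith) zero_le_one
    have h2 := smul_le_smul_of_nonneg_left this (inv_nonneg.mpr hc0.le)
    rwa [smul_smul, inv_mul_cancel₀ hc0.ne', one_smul] at h2
  have h := hΦ.mul_self_le_of_le_one (smul_nonneg (inv_nonneg.mpr hc0.le) hX) h1
  simp only [smul_mul_smul_comm, map_real_smul] at h
  have h2 := smul_le_smul_of_nonneg_left h (mul_self_nonneg c)
  simp only [smul_smul] at h2
  have e : c * c * (c⁻¹ * c⁻¹) = 1 := by field_simp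
  simpa [e] using h2

theorem exists_sqrt_inverse {C Ci : H →L[ℂ] H} (hC : IsStrictlyPositive C) (hCi : C * Ci = 1) :
    ∃ c ci : H →L[ℂ] H, 0 ≤ c ∧ 0 ≤ ci ∧ c * ci = 1 ∧ ci * c = 1 ∧ c * c = C ∧ ci * ci = Ci := by
  have h1 : C ^ (1 / 2 : ℝ) * C ^ (1 / 2 : ℝ) = C := by
    rw [← CFC.rpow_add hC.isUnit, add_halves, CFC.rpow_one C hC.nonneg]
  have h2 := CFC.rpow_mul_rpow_neg (1 / 2 : ℝ) hC
  have h3 := CFC.rpow_neg_mul_rpow (1 / 2 : ℝ) hC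
  refine ⟨C ^ (1 / 2 : ℝ), C ^ (-(1 / 2) : ℝ), CFC.rpow_nonneg, CFC.rpow_nonneg, h2, h3, h1, ?_⟩
  refine left_inv_eq_right_inv (a := C) ?_ hCi
  conv_lhs => enter [2]; rw [← h1]
  rw [mul_assoc, ← mul_assoc _ (C ^ (1 / 2 : ℝ)) (C ^ (1 / 2 : ℝ)), h3, one_mul, h3]

/-- A generalized **Choi inequality** `Φ(B) Φ(C)⁻¹ Φ(B) ≤ Φ(B C⁻¹ B)`. -/
theorem mul_inv_mul_le (hΦ : IsUnitalPositiveMap Φ) {B C Ci Di : H →L[ℂ] H} (hB : 0 ≤ B)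
    (hC : IsStrictlyPositive C) (hCi : C * Ci = 1) (hDi : Φ C * Di = 1) :
    Φ B * Di * Φ B ≤ Φ (B * Ci * B) := by
  obtain ⟨c, ci, hc, hci, h1, h2, h3, h4⟩ := exists_sqrt_inverse hC hCi
  obtain ⟨g, gi, hg, hgi, k1, k2, k3, k4⟩ :=
    exists_sqrt_inverse (hΦ.map_isStrictlyPositive hC) hDi
  let Ψ : (H →L[ℂ] H) →ₗ[ℂ] (H →L[ℂ] H) :=
    LinearMap.mulLeftRight ℂ (gi, gi) ∘ₗ Φ ∘ₗ LinearMap.mulLeftRight ℂ (c, c)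
  have hΨa : ∀ Y, Ψ Y = gi * Φ (c * Y * c) * gi := fun Y => by
    simp [Ψ, LinearMap.mulLeftRight_apply]
  have hΨ : IsUnitalPositiveMap Ψ := by
    constructor
    · rw [hΨa, mul_one, h3, ← k3, ← mul_assoc, k2, one_mul, k1]
    · intro X hX
      rw [hΨa]
      exact hgi.isSelfAdjoint.conjugate_nonneg (hΦ.2 _ (hc.isSelfAdjoint.conjugate_nonneg hX))
  have key := hΨ.mul_self_le (X := ci * B * ci) (hci.isSelfAdjoint.conjugate_nonneg hB)
  have e1 : c * (ci * B * ci) * c = B := by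
    calc c * (ci * B * ci) * c = (c * ci) * B * (ci * c) := by simp only [mul_assoc]
      _ = B := by rw [h1, h2, one_mul, mul_one]
  have e2 : c * (ci * B * ci * (ci * B * ci)) * c = B * Ci * B := by
    calc c * (ci * B * ci * (ci * B * ci)) * c
        = (c * ci) * B * (ci * ci) * B * (ci * c) := by simp only [mul_assoc]
      _ = B * Ci * B := by rw [h1, h2, h4, one_mul, mul_one]
  rw [hΨa, hΨa, e1, e2] at key
  have key2 := hg.isSelfAdjoint.conjugate_le_conjugate key
  have e3 : g * (gi * Φ B * gi * (gi * Φ B * gi)) * g = Φ B * Di * Φ B := by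
    calc g * (gi * Φ B * gi * (gi * Φ B * gi)) * g
        = (g * gi) * Φ B * (gi * gi) * Φ B * (gi * g) := by simp only [mul_assoc]
      _ = Φ B * Di * Φ B := by rw [k1, k2, k4, one_mul, mul_one]
  have e4 : g * (gi * Φ (B * Ci * B) * gi) * g = Φ (B * Ci * B) := by
    calc g * (gi * Φ (B * Ci * B) * gi) * g
        = (g * gi) * Φ (B * Ci * B) * (gi * g) := by simp only [mul_assoc]
      _ = Φ (B * Ci * B) := by rw [k1, k2, one_mul, mul_one]
  rwa [e3, e4] at key2

end IsUnitalPositiveMap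

/-- Functions satisfying Jensen's inequality `Φ(k(A)) ≤ k(Φ(A))` and its companion
`Φ(A) k(Φ(A)) ≤ Φ(A k(A))` for all unital positive maps. -/
structure IsJensenOn (H : Type*) [NormedAddCommGroup H] [InnerProductSpace ℂ H]
    [CompleteSpace H] (k : ℝ → ℝ) : Prop where
  continuousOn : ContinuousOn k (Set.Ioi 0)
  map_cfc_le : ∀ (Φ : (H →L[ℂ] H) →ₗ[ℂ] (H →L[ℂ] H)), IsUnitalPositiveMap Φ →
    ∀ A : H →L[ℂ] H, IsStrictlyPositive A → Φ (cfc k A) ≤ cfc k (Φ A)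
  mul_cfc_le : ∀ (Φ : (H →L[ℂ] H) →ₗ[ℂ] (H →L[ℂ] H)), IsUnitalPositiveMap Φ →
    ∀ A : H →L[ℂ] H, IsStrictlyPositive A → Φ A * cfc k (Φ A) ≤ Φ (A * cfc k A)

theorem ContinuousOn.mono_spectrum {k : ℝ → ℝ} (hk : ContinuousOn k (Set.Ioi 0)) {A : H →L[ℂ] H}
    (hA : IsStrictlyPositive A) : ContinuousOn k (spectrum ℝ A) :=
  hk.mono (spectrum_subset_Ioi hA.nonneg hA.isUnit)

namespace IsJensenOn

theorem const_smul {k : ℝ → ℝ} (hk : IsJensenOn H k) {c : ℝ} (hc : 0 ≤ c) :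
    IsJensenOn H (fun t => c * k t) := by
  have h : ∀ A : H →L[ℂ] H, IsStrictlyPositive A → cfc (fun t => c * k t) A = c • cfc k A :=
    fun A hA => cfc_const_mul c k A (hk.continuousOn.mono_spectrum hA)
  refine ⟨continuousOn_const.mul hk.continuousOn, fun Φ hΦ A hA => ?_, fun Φ hΦ A hA => ?_⟩
  · rw [h A hA, h _ (hΦ.map_isStrictlyPositive hA), IsUnitalPositiveMap.map_real_smul]
    exact smul_le_smul_of_nonneg_left (hk.map_cfc_le Φ hΦ A hA) hc
  · rw [h A hA, h _ (hΦ.map_isStrictlyPositive hA), mul_smul_comm, mul_smul_comm,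
      IsUnitalPositiveMap.map_real_smul]
    exact smul_le_smul_of_nonneg_left (hk.mul_cfc_le Φ hΦ A hA) hc

theorem sum {κ : Type*} [Fintype κ] {k : κ → ℝ → ℝ} (hk : ∀ j, IsJensenOn H (k j)) :
    IsJensenOn H (fun t => ∑ j, k j t) := by
  have h : ∀ A : H →L[ℂ] H, IsStrictlyPositive A →
      cfc (fun t => ∑ j, k j t) A = ∑ j, cfc (k j) A := by
    intro A hA
    have := cfc_sum (s := Finset.univ) k A fun j _ => (hk j).continuousOn.mono_spectrum hA
    rw [← this]
    congr 1
    ext t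
    simp
  refine ⟨continuousOn_finsetSum _ fun j _ => (hk j).continuousOn, fun Φ hΦ A hA => ?_,
    fun Φ hΦ A hA => ?_⟩
  · rw [h A hA, h _ (hΦ.map_isStrictlyPositive hA), map_sum]
    exact Finset.sum_le_sum fun j _ => (hk j).map_cfc_le Φ hΦ A hA
  · rw [h A hA, h _ (hΦ.map_isStrictlyPositive hA), Finset.mul_sum, Finset.mul_sum, map_sum]
    exact Finset.sum_le_sum fun j _ => (hk j).mul_cfc_le Φ hΦ A hA

theorem div_affine {α β : ℝ} (hα : 0 ≤ α) (hβ : 0 ≤ β) (hαβ : 0 < α + β) :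
    IsJensenOn H (fun t => t / (α * t + β)) := by
  have hpos : ∀ t ∈ Set.Ioi (0 : ℝ), 0 < α * t + β := by
    intro t ht
    have ht' : 0 < t := ht
    rcases hα.eq_or_lt with h | h
    · rw [← h] at hαβ ⊢; linarith
    · have := mul_pos h ht'; linarith
  have hcont : ContinuousOn (fun t : ℝ => t / (α * t + β)) (Set.Ioi 0) :=
    continuousOn_id.div (by fun_prop) fun t ht => (hpos t ht).ne'
  have hconti : ContinuousOn (fun t : ℝ => (α * t + β)⁻¹) (Set.Ioi 0) :=
    ContinuousOn.inv₀ (by fun_prop) fun t ht => (hpos t ht).ne'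
  set Ci : (H →L[ℂ] H) → H →L[ℂ] H := fun A => cfc (fun t : ℝ => (α * t + β)⁻¹) A with hCi
  have hC : ∀ A : H →L[ℂ] H, IsStrictlyPositive A →
      IsStrictlyPositive (α • A + β • (1 : H →L[ℂ] H)) := by
    intro A hA
    rcases hα.eq_or_lt with h | h
    · rw [← h, zero_smul, zero_add]
      exact IsStrictlyPositive.smul (by linarith) isStrictlyPositive_one
    · exact (hA.smul h).add_nonneg (smul_nonneg hβ zero_le_one)
  have hCeq : ∀ A : H →L[ℂ] H, IsStrictlyPositive A →
      α • A + β • (1 : H →L[ℂ] H) = cfc (fun t : ℝ => α * t + β) A := by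
    intro A hA
    have hsa := hA.nonneg.isSelfAdjoint
    rw [cfc_add_const β (fun t => α * t) A, cfc_const_mul_id α A, Algebra.algebraMap_eq_smul_one]
  have hCCi : ∀ A : H →L[ℂ] H, IsStrictlyPositive A →
      (α • A + β • (1 : H →L[ℂ] H)) * Ci A = 1 := by
    intro A hA
    have hsa := hA.nonneg.isSelfAdjoint
    have hsp := spectrum_subset_Ioi hA.nonneg hA.isUnit
    rw [hCeq A hA, hCi, ← cfc_mul _ _ A (by fun_prop) (hconti.mono_spectrum hA),
      ← cfc_one ℝ A]
    exact cfc_congr fun t ht => mul_inv_cancel₀ (hpos t (hsp ht)).ne'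
  have hg : ∀ A : H →L[ℂ] H, IsStrictlyPositive A →
      cfc (fun t : ℝ => t / (α * t + β)) A = A * Ci A ∧
      cfc (fun t : ℝ => t / (α * t + β)) A = Ci A * A := by
    intro A hA
    have hsa := hA.nonneg.isSelfAdjoint
    have h1 : A * Ci A = cfc (fun t : ℝ => t / (α * t + β)) A := by
      conv_lhs => enter [1]; rw [← cfc_id' ℝ A]
      rw [hCi, ← cfc_mul _ _ A (by fun_prop) (hconti.mono_spectrum hA)]
      rfl
    have h2 : Ci A * A = cfc (fun t : ℝ => t / (α * t + β)) A := by
      conv_lhs => enter [2]; rw [← cfc_id' ℝ A]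
      rw [hCi, ← cfc_mul _ _ A (hconti.mono_spectrum hA) (by fun_prop)]
      exact cfc_congr fun t _ => by rw [div_eq_inv_mul]
    exact ⟨h1.symm, h2.symm⟩
  have hres : ∀ A : H →L[ℂ] H, IsStrictlyPositive A →
      α • cfc (fun t : ℝ => t / (α * t + β)) A = 1 - β • Ci A := by
    intro A hA
    rw [eq_sub_iff_add_eq, ← hCCi A hA, add_mul, smul_mul_assoc, smul_mul_assoc, one_mul,
      (hg A hA).1]
  refine ⟨hcont, fun Φ hΦ A hA => ?_, fun Φ hΦ A hA => ?_⟩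
  · have hT := hΦ.map_isStrictlyPositive hA
    have hΦC : Φ (α • A + β • (1 : H →L[ℂ] H)) = α • Φ A + β • (1 : H →L[ℂ] H) := by
      rw [map_add, IsUnitalPositiveMap.map_real_smul, IsUnitalPositiveMap.map_real_smul, hΦ.1]
    rcases hα.eq_or_lt with h | h
    · have hβ' : 0 < β := by linarith
      have e : ∀ B : H →L[ℂ] H, IsStrictlyPositive B →
          cfc (fun t : ℝ => t / (α * t + β)) B = β⁻¹ • B := by
        intro B hB
        have hsa := hB.nonneg.isSelfAdjoint
        rw [← cfc_const_mul_id β⁻¹ B]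
        exact cfc_congr fun t _ => by simp [← h, div_eq_inv_mul]
      rw [e A hA, e _ hT, IsUnitalPositiveMap.map_real_smul]
    · have key := hΦ.mul_inv_mul_le (B := 1) zero_le_one (hC A hA) (hCCi A hA)
        (Di := Ci (Φ A)) (by rw [hΦC, hCCi _ hT])
      rw [hΦ.1] at key
      simp only [one_mul, mul_one] at key
      have h1 : α • Φ (cfc (fun t : ℝ => t / (α * t + β)) A)
          ≤ α • cfc (fun t : ℝ => t / (α * t + β)) (Φ A) := by
        rw [hres _ hT, ← IsUnitalPositiveMap.map_real_smul, hres A hA, map_sub, hΦ.1,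
          IsUnitalPositiveMap.map_real_smul]
        exact sub_le_sub_left (smul_le_smul_of_nonneg_left key hβ) _
      have h2 := smul_le_smul_of_nonneg_left h1 (inv_nonneg.mpr hα)
      rwa [inv_smul_smul₀ h.ne', inv_smul_smul₀ h.ne'] at h2
  · have hT := hΦ.map_isStrictlyPositive hA
    have hΦC : Φ (α • A + β • (1 : H →L[ℂ] H)) = α • Φ A + β • (1 : H →L[ℂ] H) := by
      rw [map_add, IsUnitalPositiveMap.map_real_smul, IsUnitalPositiveMap.map_real_smul, hΦ.1]
    have key := hΦ.mul_inv_mul_le (B := A) hA.nonneg (hC A hA) (hCCi A hA)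
      (Di := Ci (Φ A)) (by rw [hΦC, hCCi _ hT])
    rwa [(hg _ hT).2, (hg A hA).2, ← mul_assoc, ← mul_assoc]

end IsJensenOn

/-- An operator concave function agrees on finitely many points with an increasing positive
function satisfying Jensen's inequality. -/
theorem IsOperatorConcaveOn.exists_isJensenOn_eqOn {d : ℕ} {e : Fin d → H}
    (he : Orthonormal ℂ e) {f : ℝ → ℝ} (hfc : ContinuousOn f (Set.Ioi 0))
    (hfpos : ∀ t ∈ Set.Ioi (0 : ℝ), 0 < f t) (hf : IsOperatorConcaveOn H f) {S : Finset ℝ}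
    (hS : ∀ z ∈ S, 0 < z) (hd : S.card ≤ d) (hne : S.Nonempty) :
    ∃ k : ℝ → ℝ, IsJensenOn H k ∧ MonotoneOn k (Set.Ioi 0) ∧ (∀ t ∈ Set.Ioi (0 : ℝ), 0 < k t) ∧
      Set.EqOn f k S := by
  obtain ⟨t₁, ht₁⟩ := hne
  have ht₁0 := hS t₁ ht₁
  have hft₁ : 0 < f t₁ := hfpos t₁ ht₁0
  obtain ⟨κ, _, w, u, hw, hw1, hu, h⟩ := hf.exists_interpolation he hfc hfpos hS hd ht₁
  have hden : ∀ t : ℝ, 0 < t → ∀ j, 0 < (1 - u j) * t + u j * t₁ := by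
    intro t ht j
    rcases (hu j).1.eq_or_lt with h | h
    · rw [← h]; simpa using ht
    · have h1 := mul_pos h ht₁0
      have h2 := mul_nonneg (sub_nonneg.mpr (hu j).2) ht.le
      linarith
  refine ⟨fun t => f t₁ * ∑ j, w j * (t / ((1 - u j) * t + u j * t₁)), ?_, ?_, ?_,
    fun t ht => h t ht⟩
  · refine IsJensenOn.const_smul (IsJensenOn.sum fun j => ?_) hft₁.le
    refine IsJensenOn.const_smul (IsJensenOn.div_affine (sub_nonneg.mpr (hu j).2)
      (mul_nonneg (hu j).1 ht₁0.le) ?_) (hw j)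
    simpa using hden 1 one_pos j
  · intro s hs t ht hst
    refine mul_le_mul_of_nonneg_left (Finset.sum_le_sum fun j _ => ?_) hft₁.le
    refine mul_le_mul_of_nonneg_left ?_ (hw j)
    rw [div_le_div_iff₀ (hden s hs j) (hden t ht j)]
    have := mul_le_mul_of_nonneg_right hst (mul_nonneg (hu j).1 ht₁0.le)
    linarith
  · intro t ht
    have ht' : 0 < t := ht
    refine mul_pos hft₁ (Finset.sum_pos' (fun j _ => mul_nonneg (hw j)
      (div_pos ht' (hden t ht' j)).le) ?_)
    by_contra hcon
    push Not at hcon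
    have hz : ∀ j, w j = 0 := fun j => by
      by_contra hj
      exact absurd (hcon j (Finset.mem_univ j)) (not_le.mpr
        (mul_pos (lt_of_le_of_ne (hw j) (Ne.symm hj)) (div_pos ht' (hden t ht' j))))
    simp [hz] at hw1

/-- In infinite dimension, a positive operator concave function is a uniform limit on compact
intervals of functions satisfying Jensen's inequality. -/
theorem IsOperatorConcaveOn.exists_isJensenOn_near {f : ℝ → ℝ}
    (hH : ∀ d : ℕ, ∃ e : Fin d → H, Orthonormal ℂ e)
    (hfc : ContinuousOn f (Set.Ioi 0)) (hfpos : ∀ t ∈ Set.Ioi (0 : ℝ), 0 < f t)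
    (hf : IsOperatorConcaveOn H f) {a b ε : ℝ} (ha : 0 < a) (hε : 0 < ε) :
    ∃ k : ℝ → ℝ, IsJensenOn H k ∧ ∀ t ∈ Set.Icc a b, |f t - k t| ≤ ε := by
  have huc : UniformContinuousOn f (Set.Icc a (b + 1)) :=
    isCompact_Icc.uniformContinuousOn_of_continuous (hfc.mono fun t ht => ha.trans_le ht.1)
  obtain ⟨δ, hδ, hfδ⟩ := Metric.uniformContinuousOn_iff_le.mp huc ε hε
  obtain ⟨η, hη, hηδ⟩ := exists_between (lt_min hδ one_pos)
  have hηδ' := hηδ.trans_le (min_le_left _ _)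
  have hη1 := hηδ.trans_le (min_le_right _ _)
  set N := ⌊(b - a) / η⌋₊ + 2 with hN
  set S : Finset ℝ := (Finset.range N).image fun i : ℕ => a + i * η with hS
  obtain ⟨e, he⟩ := hH N
  have hSpos : ∀ z ∈ S, 0 < z := by
    intro z hz
    obtain ⟨i, -, rfl⟩ := Finset.mem_image.mp hz
    positivity
  have hmem : ∀ i : ℕ, i < N → a + i * η ∈ S := fun i hi =>
    Finset.mem_image.mpr ⟨i, Finset.mem_range.mpr hi, rfl⟩
  obtain ⟨k, hk, hmono, -, heq⟩ := hf.exists_isJensenOn_eqOn he hfc hfpos hSpos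
    (Finset.card_image_le.trans (Finset.card_range N).le) ⟨_, hmem 0 (by omega)⟩
  refine ⟨k, hk, fun t ht => ?_⟩
  set i := ⌊(t - a) / η⌋₊ with hi
  have hiN : i + 1 < N := by
    have : i ≤ ⌊(b - a) / η⌋₊ := Nat.floor_mono (by gcongr; exact ht.2)
    omega
  have h1 : a + i * η ≤ t := by
    have := Nat.floor_le (div_nonneg (sub_nonneg.mpr ht.1) hη.le)
    rw [le_div_iff₀ hη] at this
    linarith
  have h2 : t < a + (i + 1 : ℕ) * η := by
    have := Nat.lt_floor_add_one ((t - a) / η)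
    rw [div_lt_iff₀ hη] at this
    push_cast
    linarith
  have ha1 : a ≤ a + i * η := le_add_of_nonneg_right (by positivity)
  have h3 : a + (i + 1 : ℕ) * η = a + i * η + η := by push_cast; ring
  have ht0 : 0 < t := ha.trans_le ht.1
  have k1 := hmono (ha.trans_le ha1) ht0 h1
  have k2 := hmono ht0 (ht0.trans h2) h2.le
  rw [← heq (hmem i (by omega))] at k1
  rw [← heq (hmem (i + 1) hiN)] at k2
  have htm : t ∈ Set.Icc a (b + 1) := ⟨ht.1, by linarith [ht.2]⟩
  have d1 := hfδ t htm (a + i * η) ⟨ha1, h1.trans htm.2⟩ (by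
    rw [Real.dist_eq, abs_le]; constructor <;> linarith)
  have d2 := hfδ t htm (a + (i + 1 : ℕ) * η) ⟨ht.1.trans h2.le, by linarith [ht.2]⟩ (by
    rw [Real.dist_eq, abs_le]; constructor <;> linarith)
  rw [Real.dist_eq, abs_le] at d1 d2
  rw [abs_le]
  constructor <;> linarith

theorem exists_orthonormal_of_not_finiteDimensional (hH : ¬ FiniteDimensional ℂ H) (d : ℕ) :
    ∃ e : Fin d → H, Orthonormal ℂ e := by
  have hrank : (d : Cardinal) ≤ Module.rank ℂ H := by
    have : Cardinal.aleph0 ≤ Module.rank ℂ H := by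
      rw [← not_lt, Module.rank_lt_aleph0_iff]
      exact hH
    exact (Cardinal.natCast_lt_aleph0).le.trans this
  obtain ⟨v, hv⟩ := exists_linearIndependent_of_le_rank hrank
  exact ⟨_, InnerProductSpace.gramSchmidtNormed_orthonormal hv⟩

theorem card_le_finrank_of_subset_spectrum [FiniteDimensional ℂ H] (A : H →L[ℂ] H)
    {S : Finset ℝ} (hS : (S : Set ℝ) ⊆ spectrum ℝ A) : S.card ≤ Module.finrank ℂ H := by
  have hev : ∀ z : S, ∃ v : H, Module.End.HasEigenvector (A : Module.End ℂ H) ((z : ℝ) : ℂ) v := by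
    intro z
    refine Module.End.HasEigenvalue.exists_hasEigenvector ?_
    rw [Module.End.hasEigenvalue_iff_mem_spectrum]
    have h := hS z.2
    rw [spectrum.mem_iff] at h ⊢
    intro hu
    apply h
    rw [ContinuousLinearMap.isUnit_iff_bijective]
    have := (Module.End.isUnit_iff _).mp hu
    convert this using 1
    ext v
    simp [Algebra.algebraMap_eq_smul_one]
  choose v hv using hev
  have := Module.End.eigenvectors_linearIndependent' (A : Module.End ℂ H)
    (fun z : S => ((z : ℝ) : ℂ)) (fun x y h => Subtype.ext (Complex.ofReal_injective h)) v hv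
  simpa using this.fintype_card_le_finrank

theorem finite_spectrum_of_finiteDimensional [FiniteDimensional ℂ H] (A : H →L[ℂ] H) :
    (spectrum ℝ A).Finite := by
  by_contra h
  obtain ⟨S, hS, hc⟩ := Set.Infinite.exists_subset_card_eq h (Module.finrank ℂ H + 1)
  have := card_le_finrank_of_subset_spectrum A hS
  omega

theorem mul_cfc_eq_cfc {k : ℝ → ℝ} (hk : ContinuousOn k (Set.Ioi 0)) {A : H →L[ℂ] H}
    (hA : IsStrictlyPositive A) : A * cfc k A = cfc (fun t => t * k t) A := by
  have hsa := hA.nonneg.isSelfAdjoint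
  rw [cfc_mul _ _ A (by fun_prop) (hk.mono_spectrum hA), cfc_id' ℝ A]

theorem le_of_forall_pos_le_add_smul {X Y Z : H →L[ℂ] H}
    (h : ∀ ε : ℝ, 0 < ε → X ≤ Y + ε • Z) : X ≤ Y := by
  have hlim : Filter.Tendsto (fun ε : ℝ => Y + ε • Z) (nhdsWithin 0 (Set.Ioi 0)) (nhds Y) := by
    have : Continuous fun ε : ℝ => Y + ε • Z := by fun_prop
    simpa using (this.tendsto 0).mono_left nhdsWithin_le_nhds
  exact ge_of_tendsto hlim (Filter.eventually_of_mem self_mem_nhdsWithin h)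

theorem cfc_le_cfc_add_smul {f k : ℝ → ℝ} (hf : ContinuousOn f (Set.Ioi 0))
    (hk : ContinuousOn k (Set.Ioi 0)) {A : H →L[ℂ] H} (hA : IsStrictlyPositive A) {ε : ℝ}
    (h : ∀ t ∈ spectrum ℝ A, f t ≤ k t + ε) : cfc f A ≤ cfc k A + ε • (1 : H →L[ℂ] H) := by
  have hsa := hA.nonneg.isSelfAdjoint
  rw [← Algebra.algebraMap_eq_smul_one, ← cfc_add_const ε k A (hk.mono_spectrum hA)]
  exact cfc_mono h (hf.mono_spectrum hA) ((hk.mono_spectrum hA).add continuousOn_const)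

theorem mul_cfc_le_mul_cfc_add_smul {f k : ℝ → ℝ} (hf : ContinuousOn f (Set.Ioi 0))
    (hk : ContinuousOn k (Set.Ioi 0)) {A : H →L[ℂ] H} (hA : IsStrictlyPositive A) {ε : ℝ}
    (h : ∀ t ∈ spectrum ℝ A, f t ≤ k t + ε) : A * cfc f A ≤ A * cfc k A + ε • A := by
  have hsa := hA.nonneg.isSelfAdjoint
  have hk' : ContinuousOn (fun t => k t + ε) (Set.Ioi 0) := hk.add continuousOn_const
  have e : A * cfc k A + ε • A = A * cfc (fun t => k t + ε) A := by
    rw [cfc_add_const ε k A (hk.mono_spectrum hA), Algebra.algebraMap_eq_smul_one, mul_add,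
      mul_smul_comm, mul_one]
  rw [e, mul_cfc_eq_cfc hf hA, mul_cfc_eq_cfc hk' hA]
  exact cfc_mono (fun t ht => mul_le_mul_of_nonneg_left (h t ht)
      (spectrum_subset_Ioi hA.nonneg hA.isUnit ht).le)
    (continuousOn_id.mul (hf.mono_spectrum hA)) (continuousOn_id.mul (hk'.mono_spectrum hA))

/-- In infinite dimension, positive operator concave functions satisfy Jensen's inequality. -/
theorem IsOperatorConcaveOn.isJensenOn {f : ℝ → ℝ}
    (hH : ∀ d : ℕ, ∃ e : Fin d → H, Orthonormal ℂ e)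
    (hfc : ContinuousOn f (Set.Ioi 0)) (hfpos : ∀ t ∈ Set.Ioi (0 : ℝ), 0 < f t)
    (hf : IsOperatorConcaveOn H f) : IsJensenOn H f := by
  have key : ∀ (Φ : (H →L[ℂ] H) →ₗ[ℂ] (H →L[ℂ] H)), IsUnitalPositiveMap Φ →
      ∀ A : H →L[ℂ] H, IsStrictlyPositive A → ∀ ε : ℝ, 0 < ε → ∃ k : ℝ → ℝ, IsJensenOn H k ∧
      (∀ t ∈ spectrum ℝ A, |f t - k t| ≤ ε) ∧ ∀ t ∈ spectrum ℝ (Φ A), |f t - k t| ≤ ε := by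
    intro Φ hΦ A hA ε hε
    have hT := hΦ.map_isStrictlyPositive hA
    obtain ⟨a, b, ha, -, hab⟩ := exists_spectrum_subset_Icc hA.nonneg hA.isUnit
    obtain ⟨a', b', ha', -, hab'⟩ := exists_spectrum_subset_Icc hT.nonneg hT.isUnit
    obtain ⟨k, hk, h⟩ := hf.exists_isJensenOn_near hH hfc hfpos (b := max b b')
      (lt_min ha ha') hε
    exact ⟨k, hk, fun t ht => h t ⟨(min_le_left _ _).trans (hab ht).1,
        (hab ht).2.trans (le_max_left _ _)⟩,
      fun t ht => h t ⟨(min_le_right _ _).trans (hab' ht).1,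
        (hab' ht).2.trans (le_max_right _ _)⟩⟩
  refine ⟨hfc, fun Φ hΦ A hA => ?_, fun Φ hΦ A hA => ?_⟩
  · refine le_of_forall_pos_le_add_smul (Z := (2 : ℝ) • 1) fun ε hε => ?_
    obtain ⟨k, hk, h1, h2⟩ := key Φ hΦ A hA ε hε
    have s1 := hΦ.mono (cfc_le_cfc_add_smul hfc hk.continuousOn hA (ε := ε)
      fun t ht => by linarith [(abs_le.mp (h1 t ht)).2])
    have s2 := cfc_le_cfc_add_smul hk.continuousOn hfc (hΦ.map_isStrictlyPositive hA) (ε := ε)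
      fun t ht => by linarith [(abs_le.mp (h2 t ht)).1]
    rw [map_add, IsUnitalPositiveMap.map_real_smul, hΦ.1] at s1
    calc Φ (cfc f A) ≤ Φ (cfc k A) + ε • (1 : H →L[ℂ] H) := s1
      _ ≤ cfc k (Φ A) + ε • (1 : H →L[ℂ] H) := add_le_add_left (hk.map_cfc_le Φ hΦ A hA) _
      _ ≤ cfc f (Φ A) + ε • (1 : H →L[ℂ] H) + ε • (1 : H →L[ℂ] H) := add_le_add_left s2 _
      _ = cfc f (Φ A) + ε • (2 : ℝ) • (1 : H →L[ℂ] H) := by rw [two_smul, smul_add, add_assoc]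
  · refine le_of_forall_pos_le_add_smul (Z := (2 : ℝ) • Φ A) fun ε hε => ?_
    obtain ⟨k, hk, h1, h2⟩ := key Φ hΦ A hA ε hε
    have s1 := hΦ.mono (mul_cfc_le_mul_cfc_add_smul hk.continuousOn hfc hA (ε := ε)
      fun t ht => by linarith [(abs_le.mp (h1 t ht)).1])
    have s2 := mul_cfc_le_mul_cfc_add_smul hfc hk.continuousOn (hΦ.map_isStrictlyPositive hA)
      (ε := ε) fun t ht => by linarith [(abs_le.mp (h2 t ht)).2]
    rw [map_add, IsUnitalPositiveMap.map_real_smul] at s1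
    calc Φ A * cfc f (Φ A) ≤ Φ A * cfc k (Φ A) + ε • Φ A := s2
      _ ≤ Φ (A * cfc k A) + ε • Φ A := add_le_add_left (hk.mul_cfc_le Φ hΦ A hA) _
      _ ≤ Φ (A * cfc f A) + ε • Φ A + ε • Φ A := add_le_add_left s1 _
      _ = Φ (A * cfc f A) + ε • (2 : ℝ) • Φ A := by rw [two_smul, smul_add, add_assoc]

/-- In every dimension, `f(A)` can be represented as `k(A)` with `k` satisfying Jensen's
inequality. -/
theorem IsOperatorConcaveOn.exists_isJensenOn_cfc_eq {f : ℝ → ℝ}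
    (hfc : ContinuousOn f (Set.Ioi 0)) (hfpos : ∀ t ∈ Set.Ioi (0 : ℝ), 0 < f t)
    (hf : IsOperatorConcaveOn H f) {A : H →L[ℂ] H} (hA : IsStrictlyPositive A) :
    ∃ k : ℝ → ℝ, IsJensenOn H k ∧ (∀ t ∈ Set.Ioi (0 : ℝ), 0 < k t) ∧ cfc f A = cfc k A := by
  by_cases hH : FiniteDimensional ℂ H
  · rcases subsingleton_or_nontrivial H with _ | _
    · refine ⟨fun _ => 1, ?_, fun _ _ => one_pos, Subsingleton.elim _ _⟩
      exact ⟨continuousOn_const, fun _ _ _ _ => (Subsingleton.elim _ _).le,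
        fun _ _ _ _ => (Subsingleton.elim _ _).le⟩
    · have hfin := finite_spectrum_of_finiteDimensional A
      have hcoe := hfin.coe_toFinset
      have hne : (spectrum ℝ A).Nonempty :=
        ContinuousFunctionalCalculus.spectrum_nonempty A hA.nonneg.isSelfAdjoint
      obtain ⟨k, hk, -, hpos, heq⟩ := hf.exists_isJensenOn_eqOn
        (stdOrthonormalBasis ℂ H).orthonormal hfc hfpos (S := hfin.toFinset)
        (fun z hz => spectrum_subset_Ioi hA.nonneg hA.isUnit (hfin.mem_toFinset.mp hz))
        (card_le_finrank_of_subset_spectrum A hcoe.le) (hfin.toFinset_nonempty.mpr hne)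
      exact ⟨k, hk, hpos, cfc_congr (hcoe ▸ heq)⟩
  · exact ⟨f, hf.isJensenOn (exists_orthonormal_of_not_finiteDimensional hH) hfc hfpos, hfpos, rfl⟩

theorem rpow_mul_rpow_cfc_mul_rpow {k : ℝ → ℝ} (hk : ContinuousOn k (Set.Ioi 0))
    (hpos : ∀ t ∈ Set.Ioi (0 : ℝ), 0 < k t) {T : H →L[ℂ] H} (hT : IsStrictlyPositive T) (r : ℝ) :
    T ^ r * (cfc k T) ^ (2 * r) * T ^ r = (T * cfc k T) ^ (2 * r) := by
  have hsa := hT.nonneg.isSelfAdjoint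
  have hsp := spectrum_subset_Ioi hT.nonneg hT.isUnit
  have hc := hk.mono_spectrum hT
  have hcr : ContinuousOn (fun t : ℝ => t ^ r) (spectrum ℝ T) :=
    continuousOn_id.rpow_const fun t ht => Or.inl (hsp ht).ne'
  have hckr : ContinuousOn (fun t : ℝ => k t ^ (2 * r)) (spectrum ℝ T) :=
    hc.rpow_const fun t ht => Or.inl (hpos t (hsp ht)).ne'
  rw [mul_cfc_eq_cfc hk hT, CFC.rpow_eq_cfc_real (a := T),
    CFC.rpow_eq_cfc_real (a := cfc k T) (cfc_nonneg fun t ht => (hpos t (hsp ht)).le),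
    CFC.rpow_eq_cfc_real (a := cfc (fun t => t * k t) T)
      (cfc_nonneg fun t ht => (mul_pos (hsp ht) (hpos t (hsp ht))).le),
    ← cfc_comp' (fun t : ℝ => t ^ (2 * r)) k T ?_ hc,
    ← cfc_comp' (fun t : ℝ => t ^ (2 * r)) (fun t => t * k t) T ?_ (continuousOn_id.mul hc),
    ← cfc_mul _ _ T hcr hckr, ← cfc_mul (fun t => t ^ r * k t ^ (2 * r)) _ T (hcr.mul hckr) hcr]
  · refine cfc_congr fun t ht => ?_
    have ht0 : 0 < t := hsp ht
    have hk0 := hpos t ht0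
    rw [Real.mul_rpow ht0.le hk0.le, two_mul, Real.rpow_add ht0]
    ring
  · rintro _ ⟨t, ht, rfl⟩
    exact (Real.continuousAt_rpow_const _ _
      (Or.inl (mul_pos (hsp ht) (hpos t (hsp ht))).ne')).continuousWithinAt
  · rintro _ ⟨t, ht, rfl⟩
    exact (Real.continuousAt_rpow_const _ _ (Or.inl (hpos t (hsp ht)).ne')).continuousWithinAt

/-- Choi's inequality `Φ(f(A)⁻¹)⁻¹ ≤ Φ(f(A))` in terms of real powers. -/
theorem IsUnitalPositiveMap.rpow_neg_one_map_cfc_inv_le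
    {Φ : (H →L[ℂ] H) →ₗ[ℂ] (H →L[ℂ] H)} (hΦ : IsUnitalPositiveMap Φ) {f : ℝ → ℝ}
    (hfc : ContinuousOn f (Set.Ioi 0)) (hfpos : ∀ t ∈ Set.Ioi (0 : ℝ), 0 < f t)
    {A : H →L[ℂ] H} (hA : IsStrictlyPositive A) :
    IsStrictlyPositive (Φ (cfc (fun t => (f t)⁻¹) A)) ∧
      (Φ (cfc (fun t => (f t)⁻¹) A)) ^ (-1 : ℝ) ≤ Φ (cfc f A) := by
  have hsa := hA.nonneg.isSelfAdjoint
  have hsp := spectrum_subset_Ioi hA.nonneg hA.isUnit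
  have hfi : ContinuousOn (fun t => (f t)⁻¹) (Set.Ioi 0) :=
    hfc.inv₀ fun t ht => (hfpos t ht).ne'
  have h1 : cfc (fun t => (f t)⁻¹) A * cfc f A = 1 := by
    rw [← cfc_mul _ _ A (hfi.mono_spectrum hA) (hfc.mono_spectrum hA), ← cfc_one ℝ A]
    exact cfc_congr fun t ht => inv_mul_cancel₀ (hfpos t (hsp ht)).ne'
  have h2 : cfc f A * cfc (fun t => (f t)⁻¹) A = 1 := by
    rw [← h1]; exact cfc_commute_cfc _ _ A
  have hC : IsStrictlyPositive (cfc (fun t => (f t)⁻¹) A) :=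
    IsUnit.isStrictlyPositive ⟨⟨_, _, h1, h2⟩, rfl⟩
      (cfc_nonneg fun t ht => (inv_pos.mpr (hfpos t (hsp ht))).le)
  have hM := hΦ.map_isStrictlyPositive hC
  refine ⟨hM, ?_⟩
  have key := hΦ.mul_inv_mul_le (B := 1) zero_le_one hC h1
    (Di := (Φ (cfc (fun t => (f t)⁻¹) A)) ^ (-1 : ℝ)) (by
      conv_lhs => enter [1]; rw [← CFC.rpow_one (Φ (cfc (fun t => (f t)⁻¹) A)) hM.nonneg]
      exact CFC.rpow_mul_rpow_neg 1 hM)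
  simpa [hΦ.1] using key

/-- **Proposition 2.8.** If `f : (0,∞) → (0,∞)` is continuous, `f²` is operator concave, and
`0 ≤ r ≤ 1/2`, then `|Φ(f(A)⁻¹)^(-r) Φ(A)^r| ≤ Φ(A f(A))^r` for every unital positive linear
map `Φ` and every positive invertible operator `A`. -/
theorem abs_rpow_le_choi_davis
    (Φ : (H →L[ℂ] H) →ₗ[ℂ] (H →L[ℂ] H)) (hΦ : IsUnitalPositiveMap Φ)
    (f : ℝ → ℝ)
    (hfc : ContinuousOn f (Set.Ioi 0))
    (hfpos : ∀ t ∈ Set.Ioi (0 : ℝ), 0 < f t)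
    (hf2 : IsOperatorConcaveOn H (fun t => f t ^ 2))
    (r : ℝ) (hr0 : 0 ≤ r) (hr1 : r ≤ 1 / 2)
    (A : H →L[ℂ] H) (hA : 0 ≤ A) (hAu : IsUnit A) :
    opAbs (CFC.rpow (Φ (cfc (fun t => (f t)⁻¹) A)) (-r) * CFC.rpow (Φ A) r) ≤
      CFC.rpow (Φ (A * cfc f A)) r := by
  have hA' : IsStrictlyPositive A := hAu.isStrictlyPositive hA
  have hT := hΦ.map_isStrictlyPositive hA'
  obtain ⟨hM, hMle⟩ := hΦ.rpow_neg_one_map_cfc_inv_le hfc hfpos hA'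
  obtain ⟨k, hk, hkpos, hfk⟩ :=
    (IsOperatorConcaveOn.of_sq hfc hfpos hf2).exists_isJensenOn_cfc_eq hfc hfpos hA'
  have h2r : 2 * r ∈ Set.Icc (0 : ℝ) 1 := ⟨by linarith, by linarith⟩
  rw [CFC.rpow_eq_pow, CFC.rpow_eq_pow, CFC.rpow_eq_pow, opAbs]
  set M := Φ (cfc (fun t => (f t)⁻¹) A)
  have hMsq : M ^ (-r) * M ^ (-r) = (M ^ (-1 : ℝ)) ^ (2 * r) := by
    rw [← CFC.rpow_add hM.isUnit, CFC.rpow_rpow M (-1) (2 * r) (by norm_num) hM]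
    congr 1
    ring
  have hTr : IsSelfAdjoint (Φ A ^ r) := CFC.rpow_nonneg.isSelfAdjoint
  have hMr : IsSelfAdjoint (M ^ (-r)) := CFC.rpow_nonneg.isSelfAdjoint
  have hstar : star (M ^ (-r) * Φ A ^ r) * (M ^ (-r) * Φ A ^ r)
      = Φ A ^ r * (M ^ (-1 : ℝ)) ^ (2 * r) * Φ A ^ r := by
    rw [star_mul, hTr.star_eq, hMr.star_eq, ← hMsq]
    simp only [mul_assoc]
  have hsqrt : CFC.sqrt (Φ (A * cfc f A) ^ (2 * r)) = Φ (A * cfc f A) ^ r := by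
    have := CFC.sqrt_rpow_nnreal (a := Φ (A * cfc f A)) (x := (2 * r).toNNReal)
    rwa [Real.coe_toNNReal _ h2r.1, mul_div_cancel_left₀ r two_ne_zero] at this
  rw [hstar, ← hsqrt]
  refine CFC.sqrt_le_sqrt _ _ ?_
  calc Φ A ^ r * (M ^ (-1 : ℝ)) ^ (2 * r) * Φ A ^ r
      ≤ Φ A ^ r * (cfc k (Φ A)) ^ (2 * r) * Φ A ^ r :=
        hTr.conjugate_le_conjugate (CFC.rpow_le_rpow h2r
          (hMle.trans (hfk ▸ hk.map_cfc_le Φ hΦ A hA')))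
    _ = (Φ A * cfc k (Φ A)) ^ (2 * r) := rpow_mul_rpow_cfc_mul_rpow hk.continuousOn hkpos hT r
    _ ≤ Φ (A * cfc f A) ^ (2 * r) :=
        CFC.rpow_le_rpow h2r (hfk ▸ hk.mul_cfc_le Φ hΦ A hA')
end

section
/- Let Φ be a unital positive linear map on B(H), let A ∈ B(H) be a positive invertible operator, and let 1/2 ≤ r < 1. Then Φ(A)^r − Φ(A^r) ≥ ω(A,r) · I, where ω(A,r) = ‖Φ(A)‖^r − ( ‖Φ(A)‖ − inf over positive integers n of ‖(Φ(A) + (1/n)I − Φ(A^r)^{1/r})^{−1}‖^{−1} )^r. -/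
open scoped NNReal

variable {H : Type*} [NormedAddCommGroup H] [InnerProductSpace ℂ H] [CompleteSpace H]

/-- The constant `ω(A,r)` (relative to the unital positive linear map `Φ`):
`ω(A,r) = ‖Φ(A)‖^r − (‖Φ(A)‖ − inf_{n ≥ 1} ‖(Φ(A) + n⁻¹ I − Φ(A^r)^(1/r))⁻¹‖⁻¹)^r`. -/
noncomputable def omegaConst (Φ : (H →L[ℂ] H) →ₗ[ℂ] (H →L[ℂ] H)) (A : H →L[ℂ] H) (r : ℝ) : ℝ :=
  ‖Φ A‖ ^ r -
    (‖Φ A‖ - ⨅ n : ℕ+, ‖Ring.inverse (Φ A + ((n : ℕ) : ℝ)⁻¹ • (1 : H →L[ℂ] H) -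
        CFC.rpow (Φ (CFC.rpow A r)) (1 / r))‖⁻¹) ^ r

section CStar

open Set MeasureTheory Real
open scoped unitInterval

/-- Rescaled Bernstein polynomials: a partition of unity on `[0, s]` that reproduces the identity
and approximates a given continuous function from its values at the nodes. -/
lemma exists_bernstein_partition {s : ℝ} (hs : 0 < s) {f : ℝ → ℝ} (hf : ContinuousOn f (Icc 0 s))
    {ε : ℝ} (hε : 0 < ε) :
    ∃ (n : ℕ) (c : Fin (n + 1) → ℝ) (b : Fin (n + 1) → ℝ → ℝ),
      (∀ k, 0 ≤ c k) ∧ (∀ k, Continuous (b k)) ∧ (∀ k, ∀ x ∈ Icc 0 s, 0 ≤ b k x) ∧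
      (∀ x, ∑ k, b k x = 1) ∧ (∀ x, ∑ k, c k * b k x = x) ∧
      ∀ x ∈ Icc 0 s, ∑ k, f (c k) * b k x ≤ f x + ε := by
  have hmem : ∀ x : I, s * (x : ℝ) ∈ Icc 0 s := fun x =>
    ⟨mul_nonneg hs.le x.2.1, mul_le_of_le_one_right hs.le x.2.2⟩
  let g : C(I, ℝ) := ⟨fun x => f (s * x), hf.comp_continuous (by fun_prop) hmem⟩
  obtain ⟨n, hn, hn0⟩ := (((Metric.tendsto_nhds.1 (bernsteinApproximation_uniform g)) ε hε).and
    (Filter.eventually_ne_atTop 0)).exists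
  have hn0' : (n : ℝ) ≠ 0 := by exact_mod_cast hn0
  refine ⟨n, fun k => s * (k / n), fun k x => (bernsteinPolynomial ℝ n k).eval (x / s),
    fun k => by positivity, fun k => by fun_prop, fun k x hx => ?_, fun x => ?_, fun x => ?_,
    fun x hx => ?_⟩
  · have hx' : x / s ∈ I := ⟨div_nonneg hx.1 hs.le, (div_le_one hs).2 hx.2⟩
    exact bernstein_nonneg (n := n) (ν := k) (x := ⟨x / s, hx'⟩)
  · have := congrArg (Polynomial.eval (x / s)) (bernsteinPolynomial.sum ℝ n)
    simpa [Polynomial.eval_finsetSum, Finset.sum_range] using this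
  · have := congrArg (Polynomial.eval (x / s)) (bernsteinPolynomial.sum_smul ℝ n)
    simp only [Polynomial.eval_finsetSum, Finset.sum_range, nsmul_eq_mul, Polynomial.eval_mul,
      Polynomial.eval_natCast, Polynomial.eval_X] at this
    calc _ = s / n * ∑ k : Fin (n + 1), (k : ℝ) * (bernsteinPolynomial ℝ n k).eval (x / s) := by
          rw [Finset.mul_sum]; exact Finset.sum_congr rfl fun k _ => by ring
      _ = x := by rw [this]; field_simp
  · have hx' : x / s ∈ I := ⟨div_nonneg hx.1 hs.le, (div_le_one hs).2 hx.2⟩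
    have h1 := (ContinuousMap.dist_apply_le_dist (f := bernsteinApproximation n g) (g := g)
      ⟨x / s, hx'⟩).trans hn.le
    rw [Real.dist_eq, bernsteinApproximation.apply] at h1
    have h2 := (abs_le.1 h1).2
    have h3 : g ⟨x / s, hx'⟩ = f x := by simp [g, mul_div_cancel₀ _ hs.ne']
    rw [h3] at h2
    have h4 : ∑ k : Fin (n + 1), bernstein n k ⟨x / s, hx'⟩ • g (bernstein.z k) =
        ∑ k : Fin (n + 1), f (s * (k / n)) * (bernsteinPolynomial ℝ n k).eval (x / s) :=
      Finset.sum_congr rfl fun k _ => by simp [g, bernstein.z, bernstein, mul_comm]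
    linarith

lemma rpow_sub_rpow_sub_antitone {r d t N : ℝ} (hr0 : 0 ≤ r) (hr1 : r ≤ 1) (hd : 0 ≤ d)
    (hdt : d ≤ t) (htN : t ≤ N) :
    N ^ r - (N - d) ^ r ≤ t ^ r - (t - d) ^ r := by
  obtain rfl | hd := hd.eq_or_lt
  · simp
  have hpos : 0 < N - t + d := by linarith
  have hconc := (Real.concaveOn_rpow hr0 hr1).2 (x := N) (y := t - d)
    (by simp; linarith) (by simp; linarith)
  have h1 := hconc (a := d / (N - t + d)) (b := (N - t) / (N - t + d)) (by positivity)
    (div_nonneg (by linarith) hpos.le) (by field_simp; ring)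
  have h2 := hconc (a := (N - t) / (N - t + d)) (b := d / (N - t + d))
    (div_nonneg (by linarith) hpos.le) (by positivity) (by field_simp)
  have e1 : d / (N - t + d) * N + (N - t) / (N - t + d) * (t - d) = t := by field_simp; ring
  have e2 : (N - t) / (N - t + d) * N + d / (N - t + d) * (t - d) = N - d := by field_simp; ring
  simp only [smul_eq_mul] at h1 h2
  rw [e1] at h1
  rw [e2] at h2
  have e3 : d / (N - t + d) + (N - t) / (N - t + d) = 1 := by field_simp; ring
  have : d / (N - t + d) = 1 - (N - t) / (N - t + d) := by linarith
  rw [this] at h1 h2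
  linarith

variable {𝒜 ι : Type*} [CStarAlgebra 𝒜] [PartialOrder 𝒜] [StarOrderedRing 𝒜] [Fintype ι]

/-- Jensen's inequality for `x ↦ x⁻¹` and an operator-valued probability vector. -/
lemma ringInverse_sum_smul_le {E : ι → 𝒜} (hE : ∀ i, 0 ≤ E i) (hE1 : ∑ i, E i = 1)
    {c : ι → ℝ} (hc : ∀ i, 0 < c i) (hu : IsUnit (∑ i, c i • E i)) :
    Ring.inverse (∑ i, c i • E i) ≤ ∑ i, (c i)⁻¹ • E i := by
  set Y := ∑ i, c i • E i with hY
  set Z := Ring.inverse Y with hZ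
  have hYsa : IsSelfAdjoint Y :=
    .of_nonneg (Finset.sum_nonneg fun i _ => smul_nonneg (hc i).le (hE i))
  have hZsa : star Z = Z := by rw [hZ, ← Ring.inverse_star, hYsa.star_eq]
  have hterm : ∀ i, (c i)⁻¹ • (star (1 - c i • Z) * E i * (1 - c i • Z)) =
      (c i)⁻¹ • E i - Z * E i - E i * Z + Z * (c i • E i) * Z := by
    intro i
    have hne := (hc i).ne'
    simp only [star_sub, star_one, star_smul, star_trivial, hZsa, sub_mul, mul_sub, one_mul,
      mul_one, smul_mul_assoc, mul_smul_comm, smul_sub, smul_smul]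
    simp only [inv_mul_cancel₀ hne, one_smul, inv_mul_cancel_left₀ hne]
    abel
  have hsum : ∑ i, ((c i)⁻¹ • E i - Z * E i - E i * Z + Z * (c i • E i) * Z) =
      ∑ i, (c i)⁻¹ • E i - Z := by
    rw [Finset.sum_add_distrib, Finset.sum_sub_distrib, Finset.sum_sub_distrib, ← Finset.mul_sum,
      ← Finset.sum_mul, ← Finset.sum_mul, ← Finset.mul_sum, hE1, ← hY, hZ,
      Ring.inverse_mul_cancel _ hu]
    simp
  rw [← sub_nonneg, ← hsum]
  refine Finset.sum_nonneg fun i _ => ?_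
  rw [← hterm]
  exact smul_nonneg (inv_nonneg.2 (hc i).le) (star_left_conjugate_nonneg (hE i) _)

/-- Jensen's inequality for `x ↦ x ^ 2` and an operator-valued probability vector. -/
lemma sq_sum_smul_le {E : ι → 𝒜} (hE : ∀ i, 0 ≤ E i) (hE1 : ∑ i, E i = 1) (c : ι → ℝ) :
    (∑ i, c i • E i) ^ 2 ≤ ∑ i, (c i ^ 2) • E i := by
  set M := ∑ i, c i • E i with hM
  have hMsa : star M = M := by
    simp [hM, star_sum, (IsSelfAdjoint.of_nonneg (hE _)).star_eq]
  have hterm : ∀ i, star (c i • (1 : 𝒜) - M) * E i * (c i • (1 : 𝒜) - M) =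
      (c i ^ 2) • E i - M * (c i • E i) - (c i • E i) * M + M * E i * M := by
    intro i
    simp only [star_sub, star_one, star_smul, star_trivial, hMsa, sub_mul, mul_sub, one_mul,
      mul_one, smul_mul_assoc, mul_smul_comm, smul_sub, smul_smul, pow_two]
    abel
  have hsum : ∑ i, ((c i ^ 2) • E i - M * (c i • E i) - (c i • E i) * M + M * E i * M) =
      ∑ i, (c i ^ 2) • E i - M ^ 2 := by
    rw [Finset.sum_add_distrib, Finset.sum_sub_distrib, Finset.sum_sub_distrib, ← Finset.mul_sum,
      ← Finset.sum_mul, ← Finset.sum_mul, ← Finset.mul_sum, hE1, ← hM]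
    simp [pow_two]
  rw [← sub_nonneg, ← hsum]
  refine Finset.sum_nonneg fun i _ => ?_
  rw [← hterm]
  exact star_left_conjugate_nonneg (hE i) _

lemma cfc_rpowIntegrand₁₂_eq {p t : ℝ} (ht : 0 < t) {a : 𝒜} (ha : 0 ≤ a) :
    cfc (rpowIntegrand₁₂ p t) a =
      t ^ (p - 1) • (t⁻¹ • a + t • Ring.inverse (algebraMap ℝ 𝒜 t + a) - 1) := by
  have hspectrum : ∀ x ∈ spectrum ℝ a, t + x ≠ 0 := by grind
  have hg : ContinuousOn (fun z : ℝ => (t + z)⁻¹) (spectrum ℝ a) := by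
    fun_prop (disch := grind -abstractProof)
  have hf : ContinuousOn (fun z : ℝ => t + z) (spectrum ℝ a) := by fun_prop
  have hi : ContinuousOn (fun z : ℝ => t⁻¹ * z) (spectrum ℝ a) := by fun_prop
  have hj : ContinuousOn (fun z : ℝ => t * (t + z)⁻¹) (spectrum ℝ a) := hg.const_mul t
  have hij : ContinuousOn (fun z : ℝ => t⁻¹ * z + t * (t + z)⁻¹) (spectrum ℝ a) := hi.add hj
  have hk : ContinuousOn (fun z : ℝ => t⁻¹ * z + t * (t + z)⁻¹ - 1) (spectrum ℝ a) :=
    hij.sub continuousOn_const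
  unfold rpowIntegrand₁₂
  rw [cfc_const_mul _ _ a hk, cfc_sub _ _ a hij continuousOn_const, cfc_add a _ _ hi hj,
    cfc_const_mul _ (fun z : ℝ => z) a continuousOn_id, cfc_const_mul _ _ a hg,
    cfc_inv _ a hspectrum hf, cfc_const_add t (fun z : ℝ => z) a continuousOn_id, cfc_id' ℝ a,
    cfc_const_one ℝ a]

lemma cfc_rpowIntegrand₁₂_sum_smul_le {E : ι → 𝒜} (hE : ∀ i, 0 ≤ E i) (hE1 : ∑ i, E i = 1)
    {c : ι → ℝ} (hc : ∀ i, 0 ≤ c i) {p t : ℝ} (ht : 0 < t) :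
    cfc (rpowIntegrand₁₂ p t) (∑ i, c i • E i) ≤ ∑ i, rpowIntegrand₁₂ p t (c i) • E i := by
  have hM : 0 ≤ ∑ i, c i • E i := Finset.sum_nonneg fun i _ => smul_nonneg (hc i) (hE i)
  have hsum : algebraMap ℝ 𝒜 t + ∑ i, c i • E i = ∑ i, (t + c i) • E i := by
    simp_rw [add_smul]
    rw [Finset.sum_add_distrib, ← Finset.smul_sum, hE1, Algebra.algebraMap_eq_smul_one]
  have hu : IsUnit (∑ i, (t + c i) • E i) := by
    rw [← hsum]
    exact ((isStrictlyPositive_algebraMap (A := 𝒜) ht).add_nonneg hM).isUnit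
  rw [cfc_rpowIntegrand₁₂_eq ht hM, hsum]
  have key := ringInverse_sum_smul_le hE hE1 (fun i => add_pos_of_pos_of_nonneg ht (hc i)) hu
  have hrhs : ∑ i, rpowIntegrand₁₂ p t (c i) • E i =
      t ^ (p - 1) • (t⁻¹ • ∑ i, c i • E i + t • ∑ i, (t + c i)⁻¹ • E i - 1) := by
    rw [← hE1]
    simp only [rpowIntegrand₁₂, Finset.smul_sum, ← Finset.sum_add_distrib,
      ← Finset.sum_sub_distrib, mul_smul, add_smul, sub_smul, one_smul]
  rw [hrhs]
  gcongr

/-- Jensen's inequality for `x ↦ x ^ p`, `1 < p ≤ 2`, and an operator-valued probability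
vector. -/
lemma rpow_sum_smul_le {E : ι → 𝒜} (hE : ∀ i, 0 ≤ E i) (hE1 : ∑ i, E i = 1)
    {c : ι → ℝ} (hc : ∀ i, 0 ≤ c i) {p : ℝ} (hp : p ∈ Ioc 1 2) :
    (∑ i, c i • E i) ^ p ≤ ∑ i, (c i ^ p) • E i := by
  have hM : 0 ≤ ∑ i, c i • E i := Finset.sum_nonneg fun i _ => smul_nonneg (hc i) (hE i)
  obtain rfl | hp2 := hp.2.eq_or_lt
  · simpa [← CFC.rpow_natCast _ 2 hM] using sq_sum_smul_le hE hE1 c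
  lift p to ℝ≥0 using by linarith [hp.1]
  have hp0 : 0 < p := by exact_mod_cast zero_lt_one.trans hp.1
  obtain ⟨μ, hμ⟩ := CFC.exists_measure_nnrpow_eq_integral_cfcₙ_rpowIntegrand₁₂ 𝒜
    (p := p) ⟨by exact_mod_cast hp.1, by exact_mod_cast hp2⟩
  have hscalar : ∀ x : ℝ, 0 ≤ x → (0 : 𝒜) ≤ algebraMap ℝ 𝒜 x := fun x hx => algebraMap_nonneg _ hx
  have hcoe : ∀ i, (c i ^ (p : ℝ)) • E i = E i * (algebraMap ℝ 𝒜 (c i)) ^ p := by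
    intro i
    rw [CFC.nnrpow_eq_rpow hp0, CFC.rpow_eq_cfc_real (hscalar _ (hc i)),
      cfc_algebraMap, ← Algebra.commutes, Algebra.smul_def]
  simp_rw [hcoe]
  rw [← CFC.nnrpow_eq_rpow hp0, (hμ _ hM).2]
  simp_rw [fun i => (hμ _ (hscalar _ (hc i))).2]
  have hint : ∀ i, IntegrableOn
      (fun t => E i * cfcₙ (rpowIntegrand₁₂ p t) (algebraMap ℝ 𝒜 (c i))) (Ioi 0) μ :=
    fun i => ((hμ _ (hscalar _ (hc i))).1).const_mul _
  have : ∀ i, E i * ∫ t in Ioi 0, cfcₙ (rpowIntegrand₁₂ p t) (algebraMap ℝ 𝒜 (c i)) ∂μ =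
      ∫ t in Ioi 0, E i * cfcₙ (rpowIntegrand₁₂ p t) (algebraMap ℝ 𝒜 (c i)) ∂μ :=
    fun i => ((ContinuousLinearMap.mul ℝ 𝒜 (E i)).integral_comp_comm
      ((hμ _ (hscalar _ (hc i))).1)).symm
  simp_rw [this]
  rw [← integral_finsetSum _ fun i _ => hint i]
  refine integral_mono_ae (hμ _ hM).1 (integrable_finsetSum _ fun i _ => hint i) ?_
  filter_upwards [ae_restrict_mem measurableSet_Ioi] with t ht
  have hcont : ContinuousOn (rpowIntegrand₁₂ (p : ℝ) t) (Ici 0) :=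
    (continuousOn_rpowIntegrand₁₂_uncurry hp.1 _ Subset.rfl).uncurry_left _ ht
  have hcfc : ∀ a : 𝒜, 0 ≤ a →
      cfcₙ (rpowIntegrand₁₂ p t) a = cfc (rpowIntegrand₁₂ p t) a := fun a ha =>
    cfcₙ_eq_cfc (hf := hcont.mono (by grind)) (hf0 := rpowIntegrand₁₂_zero ht)
  rw [hcfc _ hM]
  refine (cfc_rpowIntegrand₁₂_sum_smul_le hE hE1 hc ht).trans_eq
    (Finset.sum_congr rfl fun i _ => ?_)
  rw [hcfc _ (hscalar _ (hc i)), cfc_algebraMap, ← Algebra.commutes, Algebra.smul_def]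

variable {ℬ : Type*} [CStarAlgebra ℬ] [PartialOrder ℬ] [StarOrderedRing ℬ]

lemma le_of_forall_le_add_smul_one {a b : 𝒜} (h : ∀ ε : ℝ, 0 < ε → a ≤ b + ε • 1) : a ≤ b := by
  have hlim : Filter.Tendsto (fun ε : ℝ => b + ε • (1 : 𝒜)) (nhdsWithin 0 (Ioi 0)) (nhds b) := by
    have : Continuous fun ε : ℝ => b + ε • (1 : 𝒜) := by fun_prop
    simpa using (this.tendsto 0).mono_left nhdsWithin_le_nhds
  exact ge_of_tendsto hlim (eventually_mem_nhdsWithin.mono h)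

/-- The Choi–Davis inequality for powers with exponent in `(1, 2]`. -/
lemma rpow_map_le_map_rpow (Φ : 𝒜 →ₗ[ℝ] ℬ) (hΦ1 : Φ 1 = 1) (hΦ : ∀ a, 0 ≤ a → 0 ≤ Φ a)
    {a : 𝒜} (ha : 0 ≤ a) {p : ℝ} (hp : p ∈ Ioc 1 2) : (Φ a) ^ p ≤ Φ (a ^ p) := by
  refine le_of_forall_le_add_smul_one fun ε hε => ?_
  have hs : 0 < ‖a‖ + 1 := by positivity
  have hspec : ∀ x ∈ spectrum ℝ a, x ∈ Icc 0 (‖a‖ + 1) := fun x hx =>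
    ⟨spectrum_nonneg_of_nonneg ha hx,
      ((le_algebraMap_iff_spectrum_le (.of_nonneg ha)).1
      (IsSelfAdjoint.le_algebraMap_norm_self (.of_nonneg ha)) x hx).trans
        (by linarith)⟩
  have hpow : Continuous fun x : ℝ => x ^ p := continuous_rpow_const (by linarith [hp.1])
  obtain ⟨n, c, b, hc, hbc, hb, hb1, hbx, hbp⟩ :=
    exists_bernstein_partition hs hpow.continuousOn hε
  have hsum : ∀ w : Fin (n + 1) → ℝ,
      ∑ k, w k • Φ (cfc (b k) a) = Φ (cfc (fun x => ∑ k, w k * b k x) a) := by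
    intro w
    have hfun : (fun x => ∑ k, w k * b k x) = ∑ k, fun x => w k * b k x := by ext; simp
    rw [hfun, cfc_sum_univ _ a fun k => ((hbc k).const_mul (w k)).continuousOn, map_sum]
    refine Finset.sum_congr rfl fun k _ => ?_
    rw [cfc_const_mul _ _ a (hbc k).continuousOn, map_smul]
  have hE : ∀ k, 0 ≤ Φ (cfc (b k) a) := fun k =>
    hΦ _ (cfc_nonneg fun x hx => hb k x (hspec x hx))
  have hE1 : ∑ k, Φ (cfc (b k) a) = 1 := by
    simpa [hb1, cfc_const_one ℝ a, hΦ1] using hsum fun _ => 1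
  have hEa : ∑ k, c k • Φ (cfc (b k) a) = Φ a := by
    simp [hsum, hbx, cfc_id' ℝ a]
  have hle : cfc (fun x => ∑ k, c k ^ p * b k x) a ≤ a ^ p + ε • 1 := by
    rw [CFC.rpow_eq_cfc_real ha, ← Algebra.algebraMap_eq_smul_one,
      ← cfc_add_const ε _ a hpow.continuousOn]
    exact cfc_mono (fun x hx => hbp x (hspec x hx))
      (continuous_finsetSum _ fun k _ => (hbc k).const_mul _).continuousOn
      (hpow.add continuous_const).continuousOn
  calc (Φ a) ^ p ≤ ∑ k, (c k ^ p) • Φ (cfc (b k) a) := hEa ▸ rpow_sum_smul_le hE hE1 hc hp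
    _ = Φ (cfc (fun x => ∑ k, c k ^ p * b k x) a) := hsum _
    _ ≤ Φ (a ^ p + ε • 1) := by
      rw [← sub_nonneg, ← map_sub]
      exact hΦ _ (sub_nonneg.2 hle)
    _ = Φ (a ^ p) + ε • 1 := by rw [map_add, map_smul, hΦ1]

lemma smul_one_le_of_isStrictlyPositive {w : 𝒜} (hw : IsStrictlyPositive w) :
    ‖Ring.inverse w‖⁻¹ • (1 : 𝒜) ≤ w := by
  nontriviality 𝒜
  have hi : IsStrictlyPositive (Ring.inverse w) := hw.ringInverse
  have hnorm : 0 < ‖Ring.inverse w‖ := norm_pos_iff.2 hi.isUnit.ne_zero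
  have h := CStarAlgebra.ringInverse_le_ringInverse
    (IsSelfAdjoint.le_algebraMap_norm_self (a := Ring.inverse w) (.of_nonneg hi.nonneg)) hi
  rw [Ring.inverse_inverse hw.isUnit] at h
  refine le_trans (le_of_eq ?_) h
  rw [← Algebra.algebraMap_eq_smul_one]
  exact (Ring.inverse_unit
    ((Units.mk0 _ hnorm.ne').map (algebraMap ℝ 𝒜).toMonoidHom)).symm

lemma iInf_norm_ringInverse_smul_one_le {a : 𝒜} (ha : 0 ≤ a) :
    (⨅ n : ℕ+, ‖Ring.inverse (a + ((n : ℕ) : ℝ)⁻¹ • (1 : 𝒜))‖⁻¹) • (1 : 𝒜) ≤ a := by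
  refine le_of_forall_le_add_smul_one fun ε hε => ?_
  obtain ⟨n, hn⟩ := exists_nat_one_div_lt hε
  have hinv : ((n.succPNat : ℕ) : ℝ)⁻¹ ≤ ε := by simpa using hn.le
  have hw : IsStrictlyPositive (a + ((n.succPNat : ℕ) : ℝ)⁻¹ • (1 : 𝒜)) :=
    .nonneg_add ha (.smul (by positivity) isStrictlyPositive_one)
  calc _ ≤ ‖Ring.inverse (a + ((n.succPNat : ℕ) : ℝ)⁻¹ • (1 : 𝒜))‖⁻¹ • (1 : 𝒜) := by
        refine smul_le_smul_of_nonneg_right (ciInf_le ⟨0, ?_⟩ n.succPNat) zero_le_one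
        rintro _ ⟨m, rfl⟩
        positivity
    _ ≤ a + ((n.succPNat : ℕ) : ℝ)⁻¹ • (1 : 𝒜) := smul_one_le_of_isStrictlyPositive hw
    _ ≤ a + ε • 1 := by gcongr

lemma rpow_sub_rpow_smul_one_le {a : 𝒜} {r d : ℝ} (hr0 : 0 < r) (hr1 : r ≤ 1) (hd : 0 ≤ d)
    (hda : d • (1 : 𝒜) ≤ a) :
    (‖a‖ ^ r - (‖a‖ - d) ^ r) • (1 : 𝒜) ≤ a ^ r - (a - d • 1) ^ r := by
  have ha : 0 ≤ a := (smul_nonneg hd zero_le_one).trans hda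
  have hpow : Continuous fun x : ℝ => x ^ r := continuous_rpow_const hr0.le
  have hpow' : Continuous fun x : ℝ => (x - d) ^ r := hpow.comp (by fun_prop)
  have hsub : cfc (fun x : ℝ => x - d) a = a - d • 1 := by
    rw [cfc_sub _ _ a (continuousOn_id' _) continuousOn_const, cfc_id' ℝ a, cfc_const d a,
      Algebra.algebraMap_eq_smul_one]
  rw [← Algebra.algebraMap_eq_smul_one] at hda
  rw [← hsub, CFC.rpow_eq_cfc_real (a := cfc _ a) (hsub ▸ sub_nonneg.2 (by
      rwa [← Algebra.algebraMap_eq_smul_one])), CFC.rpow_eq_cfc_real ha,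
    ← cfc_comp' (fun x : ℝ => x ^ r) (fun x => x - d) a hpow.continuousOn (by fun_prop),
    ← cfc_sub _ _ a hpow.continuousOn hpow'.continuousOn, ← Algebra.algebraMap_eq_smul_one]
  refine algebraMap_le_cfc _ _ a (fun x hx => ?_) (hpow.sub hpow').continuousOn
  exact rpow_sub_rpow_sub_antitone hr0.le hr1 hd
    ((algebraMap_le_iff_le_spectrum (.of_nonneg ha)).1 hda x hx)
    ((le_algebraMap_iff_spectrum_le (.of_nonneg ha)).1
      (IsSelfAdjoint.le_algebraMap_norm_self (.of_nonneg ha)) x hx)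

end CStar

/-- **Lemma 3.6.** If `Φ` is a unital positive linear map, `A` is a positive (invertible)
operator, and `1/2 ≤ r < 1`, then `Φ(A)^r − Φ(A^r) ≥ ω(A,r) · I`. -/
theorem choi_davis_power_refinement
    (Φ : (H →L[ℂ] H) →ₗ[ℂ] (H →L[ℂ] H)) (hΦ : IsUnitalPositiveMap Φ)
    (A : H →L[ℂ] H) (hA : 0 ≤ A) (hAu : IsUnit A)
    (r : ℝ) (hr1 : 1 / 2 ≤ r) (hr2 : r < 1) :
    omegaConst Φ A r • (1 : H →L[ℂ] H) ≤ CFC.rpow (Φ A) r - Φ (CFC.rpow A r) := by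
  obtain ⟨hΦ1, hΦpos⟩ := hΦ
  have hr0 : 0 < r := by linarith
  have hp : 1 / r ∈ Set.Ioc (1 : ℝ) 2 :=
    ⟨(one_lt_div hr0).2 hr2, (div_le_iff₀ hr0).2 (by linarith)⟩
  have hC : 0 ≤ Φ (CFC.rpow A r) := hΦpos _ CFC.rpow_nonneg
  have hchoi : CFC.rpow (Φ (CFC.rpow A r)) (1 / r) ≤ Φ A := by
    have h := rpow_map_le_map_rpow (Φ.restrictScalars ℝ) hΦ1 hΦpos
      (CFC.rpow_nonneg (a := A) (y := r)) hp
    rwa [CFC.rpow_rpow_of_exponent_nonneg A r (1 / r) hr0.le (by positivity),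
      mul_one_div_cancel hr0.ne', CFC.rpow_one A] at h
  have hroot : CFC.rpow (CFC.rpow (Φ (CFC.rpow A r)) (1 / r)) r = Φ (CFC.rpow A r) := by
    simp only [CFC.rpow_eq_pow] at hC ⊢
    rw [CFC.rpow_rpow_of_exponent_nonneg _ (1 / r) r (by positivity) hr0.le,
      one_div_mul_cancel hr0.ne', CFC.rpow_one _]
  unfold omegaConst
  simp_rw [add_sub_right_comm]
  set C := CFC.rpow (Φ (CFC.rpow A r)) (1 / r)
  have hC0 : 0 ≤ C := CFC.rpow_nonneg
  have hgap := iInf_norm_ringInverse_smul_one_le (sub_nonneg.2 hchoi)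
  set d := ⨅ n : ℕ+, ‖Ring.inverse (Φ A - C + ((n : ℕ) : ℝ)⁻¹ • (1 : H →L[ℂ] H))‖⁻¹
  have hd : 0 ≤ d := Real.iInf_nonneg fun n => by positivity
  have hdA : d • (1 : H →L[ℂ] H) ≤ Φ A := hgap.trans (sub_le_self _ hC0)
  refine (rpow_sub_rpow_smul_one_le hr0 hr2.le hd hdA).trans ?_
  rw [← hroot]
  exact sub_le_sub_left (CFC.rpow_le_rpow ⟨hr0.le, hr2.le⟩ (le_sub_comm.1 hgap)) _
end

section
/- Let Φ be a unital positive linear map on B(H), let X ∈ B(H) be a positive invertible operator, and let α, β ≥ 0 with β < α ≤ 2β. Then Φ(X^α)^{1+β/α} ≥ |Φ(X^β) Φ(X^α)| + ( ‖Φ(X^α)^{1+β/α}‖ − ‖ Φ(X^α)^{2+β/α} − ω(X^α, β/α) · ‖Φ(X^α)^{−β/α}‖^{−2α/β} ‖^{(β+α)/(β+2α)} ) · I. -/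
open scoped NNReal

variable {H : Type*} [NormedAddCommGroup H] [InnerProductSpace ℂ H] [CompleteSpace H]

section Furuta

variable {A : Type*} [CStarAlgebra A] [PartialOrder A] [StarOrderedRing A]

/-- Furuta's identity `(x x*)^s = x (x* x)^(s-1) x*` for invertible `x`. -/
theorem rpow_mul_star_self {x : A} (hx : IsUnit x) (s : ℝ) :
    (x * star x) ^ s = x * (star x * x) ^ (s - 1) * star x := by
  have hp : IsStrictlyPositive (star x * x) :=
    CStarAlgebra.isStrictlyPositive_iff_eq_star_mul_self.mpr ⟨x, hx, rfl⟩
  set a := star x * x with ha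
  have hu : IsUnit a := hp.isUnit
  have hsa : star (a ^ (-(1 / 2) : ℝ)) = a ^ (-(1 / 2) : ℝ) := CFC.rpow_nonneg.star_eq
  have h1 : a ^ (-(1 / 2) : ℝ) * a * a ^ (-(1 / 2) : ℝ) = 1 := CFC.conjugate_rpow_neg_one_half a
  have hl : star (x * a ^ (-(1 / 2) : ℝ)) * (x * a ^ (-(1 / 2) : ℝ)) = 1 := by
    rw [star_mul, hsa, ← h1, ha]; noncomm_ring
  have hxu : IsUnit (x * a ^ (-(1 / 2) : ℝ)) := hx.mul (hu.cfcRpow _ hp.nonneg)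
  have hr : x * a ^ (-(1 / 2) : ℝ) * star (x * a ^ (-(1 / 2) : ℝ)) = 1 := by
    rw [← hxu.mul_left_inj, mul_assoc, hl, one_mul, mul_one]
  let φ := Unitary.conjStarAlgAut ℂ A ⟨_, ⟨hl, hr⟩⟩
  have hφ : ∀ y, φ y = x * (a ^ (-(1 / 2) : ℝ) * y * a ^ (-(1 / 2) : ℝ)) * star x := by
    intro y
    simp only [φ, Unitary.conjStarAlgAut_apply, star_mul, hsa, mul_assoc]
  have hφa : φ a = x * star x := by rw [hφ, h1, mul_one]
  have hmap : φ (a ^ s) = (φ a) ^ s := by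
    rw [CFC.rpow_eq_cfc_real, CFC.rpow_eq_cfc_real (by rw [hφa]; exact mul_star_self_nonneg x)]
    refine StarAlgHomClass.map_cfc (S := ℂ) φ _ a ?_ ?_ hp.isSelfAdjoint ?_
    · refine continuousOn_id.rpow_const fun t ht => Or.inl ?_
      rintro rfl
      exact spectrum.zero_notMem ℝ hu ht
    · have : (φ : A → A) = fun y => x * (a ^ (-(1 / 2) : ℝ) * y * a ^ (-(1 / 2) : ℝ)) * star x :=
        funext hφ
      rw [this]
      fun_prop
    · rw [hφa]; exact .mul_star_self x
  rw [← hφa, ← hmap, hφ, ← CFC.rpow_add hu, ← CFC.rpow_add hu]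
  ring_nf

/-- The Furuta inequality with inner exponent `p > 1` and outer exponent `s ∈ [0, 1]`. -/
theorem furuta_of_le_one {P Q : A} (hQ : IsStrictlyPositive Q) (hQP : Q ≤ P)
    {p s : ℝ} (hp : 1 < p) (hs0 : 0 ≤ s) (hs1 : s ≤ 1) :
    Q ^ (1 + s) ≤ (Q ^ (s / 2) * P ^ p * Q ^ (s / 2)) ^ ((1 + s) / (p + s)) := by
  have hP : IsStrictlyPositive P := hQ.of_le hQP
  have hQu := hQ.isUnit
  have hPu := hP.isUnit
  have hps : 0 < p + s := by linarith
  let x := Q ^ (s / 2) * P ^ (p / 2)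
  have hstar : star x = P ^ (p / 2) * Q ^ (s / 2) := by
    rw [star_mul, (hQ.rpow Q _).isSelfAdjoint.star_eq, (hP.rpow P _).isSelfAdjoint.star_eq]
  have hxu : IsUnit x := (hQu.cfcRpow _ hQ.nonneg).mul (hPu.cfcRpow _ hP.nonneg)
  have hxx : x * star x = Q ^ (s / 2) * P ^ p * Q ^ (s / 2) := by
    rw [hstar]
    conv_rhs => rw [← add_halves p, CFC.rpow_add hPu]
    simp only [x, mul_assoc]
  have hw : star x * x ≤ P ^ (p + s) := by
    have h1 : star x * x = P ^ (p / 2) * Q ^ s * P ^ (p / 2) := by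
      rw [hstar]
      conv_rhs => rw [← add_halves s, CFC.rpow_add hQu]
      simp only [x, mul_assoc]
    have h2 : P ^ (p + s) = P ^ (p / 2) * P ^ s * P ^ (p / 2) := by
      rw [← CFC.rpow_add hPu, ← CFC.rpow_add hPu]; ring_nf
    rw [h1, h2]
    exact (hP.rpow P _).isSelfAdjoint.conjugate_le_conjugate (CFC.rpow_le_rpow ⟨hs0, hs1⟩ hQP)
  have hwp : IsStrictlyPositive (star x * x) :=
    CStarAlgebra.isStrictlyPositive_iff_eq_star_mul_self.mpr ⟨x, hxu, rfl⟩
  have hmu0 : 0 < (p - 1) / (p + s) := div_pos (by linarith) hps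
  have hmu1 : (p - 1) / (p + s) ≤ 1 := by rw [div_le_one hps]; linarith
  have h3 : (star x * x) ^ ((p - 1) / (p + s)) ≤ P ^ (p - 1) := by
    have := CFC.rpow_le_rpow ⟨hmu0.le, hmu1⟩ hw
    rwa [CFC.rpow_rpow P _ _ hps.ne', mul_div_cancel₀ _ hps.ne'] at this
  have h4 : P ^ (1 - p) ≤ (star x * x) ^ ((1 + s) / (p + s) - 1) := by
    have := CStarAlgebra.rpow_neg_one_le_rpow_neg_one h3 (hwp.rpow _ _)
    rw [CFC.rpow_rpow P _ _ (by linarith), CFC.rpow_rpow _ _ _ hmu0.ne'] at this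
    convert! this using 2
    · ring
    · field_simp; ring
  rw [← hxx, rpow_mul_star_self hxu]
  calc Q ^ (1 + s) = Q ^ (s / 2) * Q * Q ^ (s / 2) := by
        conv_rhs => rw [← CFC.rpow_one Q]
        rw [CFC.rpow_rpow Q 1 _ one_ne_zero, ← CFC.rpow_add hQu, ← CFC.rpow_add hQu]
        ring_nf
    _ ≤ Q ^ (s / 2) * P * Q ^ (s / 2) :=
        (hQ.rpow Q _).isSelfAdjoint.conjugate_le_conjugate hQP
    _ = x * P ^ (1 - p) * star x := by
        rw [hstar]
        have : P = P ^ (p / 2) * P ^ (1 - p) * P ^ (p / 2) := by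
          rw [← CFC.rpow_add hPu, ← CFC.rpow_add hPu]
          ring_nf
          rw [CFC.rpow_one P]
        conv_lhs => rw [this]
        simp only [x, mul_assoc]
    _ ≤ _ := star_right_conjugate_le_conjugate h4 x

theorem rpow_le_rpow_conj_sq {B Q : A} (hQ : IsStrictlyPositive Q) (hQB : Q ≤ B)
    {r : ℝ} (hr : 1 / 2 ≤ r) (hr1 : r ≤ 1) :
    Q ^ r ≤ (Q ^ r * (B * B) * Q ^ r) ^ (r / (2 * r + 2)) := by
  have hB : IsStrictlyPositive B := hQ.of_le hQB
  have hQu := hQ.isUnit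
  have hB2 : B ^ (2 : ℝ) = B * B := by
    rw [← one_add_one_eq_two, CFC.rpow_add hB.isUnit, CFC.rpow_one B]
  have h1 := furuta_of_le_one hQ hQB (p := 2) (s := 1) (by norm_num) (by norm_num) le_rfl
  have hin : IsStrictlyPositive (Q ^ (1 / 2 : ℝ) * B ^ (2 : ℝ) * Q ^ (1 / 2 : ℝ)) := by
    have := (hQ.rpow Q (1 / 2)).isUnit
    exact ⟨conjugate_nonneg_of_nonneg CFC.rpow_nonneg CFC.rpow_nonneg,
      (this.mul (hB.rpow B 2).isUnit).mul this⟩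
  have h2 := furuta_of_le_one (hQ.rpow Q _) h1 (p := 3 / 2) (s := r - 1 / 2) (by norm_num)
    (by linarith) (by linarith)
  rw [CFC.rpow_rpow _ _ _ (by norm_num), CFC.rpow_rpow _ _ _ (by norm_num),
    CFC.rpow_rpow _ _ _ (by norm_num),
    show (1 + 1) / (2 + 1) * (3 / 2) = (1 : ℝ) by norm_num, CFC.rpow_one _ hin.nonneg] at h2
  have h3 : Q ^ ((1 + 1) * ((r - 1 / 2) / 2)) *
      (Q ^ (1 / 2 : ℝ) * B ^ (2 : ℝ) * Q ^ (1 / 2 : ℝ)) * Q ^ ((1 + 1) * ((r - 1 / 2) / 2)) =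
      Q ^ r * (B * B) * Q ^ r := by
    have e1 : Q ^ r = Q ^ ((1 + 1) * ((r - 1 / 2) / 2)) * Q ^ (1 / 2 : ℝ) := by
      rw [← CFC.rpow_add hQu]; ring_nf
    have e2 : Q ^ r = Q ^ (1 / 2 : ℝ) * Q ^ ((1 + 1) * ((r - 1 / 2) / 2)) := by
      rw [← CFC.rpow_add hQu]; ring_nf
    rw [← hB2]
    nth_rw 1 [e1]
    rw [e2]
    simp only [mul_assoc]
  rw [h3] at h2
  have h4 := CFC.rpow_le_rpow (p := r / (2 * r + 1))
    ⟨by apply div_nonneg <;> linarith, by rw [div_le_one] <;> linarith⟩ h2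
  rw [CFC.rpow_rpow _ _ _ (by linarith),
    CFC.rpow_rpow_of_exponent_nonneg _ _ _ (by apply div_nonneg <;> linarith)
      (by apply div_nonneg <;> linarith)] at h4
  have hr0 : 2 * r + 1 ≠ 0 := by linarith
  have hr2 : r + 1 ≠ 0 := by linarith
  convert! h4 using 2
  · field_simp; ring
  · rw [show 1 + (r - 1 / 2) = (2 * r + 1) / 2 by ring, show 3 / 2 + (r - 1 / 2) = r + 1 by ring]
    field_simp

theorem sqrt_conj_sq_le {B Q : A} (hQ : IsStrictlyPositive Q) (hQB : Q ≤ B)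
    {r : ℝ} (hr : 1 / 2 ≤ r) (hr1 : r ≤ 1) :
    CFC.sqrt (star (Q ^ r * B) * (Q ^ r * B)) ≤ (B * Q ^ r * B) ^ ((1 + r) / (2 + r)) := by
  have hB : IsStrictlyPositive B := hQ.of_le hQB
  have hC := hQ.rpow Q r
  have h1 := rpow_le_rpow_conj_sq hQ hQB hr hr1
  set C := Q ^ r
  have hxu : IsUnit (B * C) := hB.isUnit.mul hC.isUnit
  have hCs := hC.isSelfAdjoint.star_eq
  have hBs := hB.isSelfAdjoint.star_eq
  have hκ : r / (2 * r + 2) ≠ 0 := by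
    apply ne_of_gt; apply div_pos <;> linarith
  have hin : IsStrictlyPositive (C * (B * B) * C) := by
    refine CStarAlgebra.isStrictlyPositive_iff_eq_star_mul_self.mpr ⟨_, hxu, ?_⟩
    simp only [star_mul, hCs, hBs, mul_assoc]
  have h2 := CStarAlgebra.rpow_neg_one_le_rpow_neg_one h1 hC
  rw [CFC.rpow_rpow _ _ _ hκ] at h2
  have hr0 : 2 * r + 2 ≠ 0 := by linarith
  have hr2 : r + 2 ≠ 0 := by linarith
  have h3 : (B * C * star (B * C)) ^ ((r + 2) / (2 * r + 2)) ≤ B * C * B := by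
    rw [rpow_mul_star_self hxu]
    have e1 : star (B * C) * (B * C) = C * (B * B) * C := by
      simp only [star_mul, hCs, hBs, mul_assoc]
    have e2 : (r + 2) / (2 * r + 2) - 1 = r / (2 * r + 2) * -1 := by field_simp; ring
    have e3 : B * C * B = B * C * C ^ (-1 : ℝ) * star (B * C) := by
      have : C * C ^ (-1 : ℝ) = 1 := by
        simpa only [CFC.rpow_one C] using CFC.rpow_mul_rpow_neg (a := C) 1
      rw [mul_assoc B C (C ^ (-1 : ℝ)), this, mul_one, star_mul, hCs, hBs, mul_assoc]
    rw [e1, e2, e3]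
    exact star_right_conjugate_le_conjugate h2 _
  have h4 := CFC.rpow_le_rpow (p := (1 + r) / (2 + r))
    ⟨by apply div_nonneg <;> linarith, by rw [div_le_one] <;> linarith⟩ h3
  rw [CFC.rpow_rpow_of_exponent_nonneg _ _ _ (by apply div_nonneg <;> linarith)
      (by apply div_nonneg <;> linarith) (mul_star_self_nonneg _)] at h4
  rw [CFC.sqrt_eq_rpow]
  convert! h4 using 2
  · simp only [star_mul, hCs, hBs]
  · rw [add_comm 2 r]; field_simp; ring

end Furuta

section Jensen

variable {A : Type*} [CStarAlgebra A] [PartialOrder A] [StarOrderedRing A]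

open Filter Topology unitInterval in
/-- A positive map on `C([0,1], ℝ)` is nonnegative on the formal square of `f + g T`. -/
theorem quadratic_form_nonneg (L : C(I, ℝ) →L[ℝ] A) (hL : ∀ h, 0 ≤ h → 0 ≤ L h)
    {T : A} (hT : IsSelfAdjoint T) (f g : C(I, ℝ)) :
    0 ≤ L (f * f) + L (f * g) * T + T * L (f * g) + T * L (g * g) * T := by
  have hlim (h : C(I, ℝ)) : Tendsto (fun n => L (bernsteinApproximation n h)) atTop (𝓝 (L h)) :=
    (L.continuous.tendsto h).comp (bernsteinApproximation_uniform h)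
  have hsum (n : ℕ) (h : C(I, ℝ)) : L (bernsteinApproximation n h) =
      ∑ k : Fin (n + 1), h (bernstein.z k) • L (bernstein n k) := by
    have : bernsteinApproximation n h =
        ∑ k : Fin (n + 1), h (bernstein.z k) • bernstein n k := by
      ext x
      simp [bernsteinApproximation.apply, mul_comm]
    rw [this, map_sum]
    simp only [map_smul]
  refine ge_of_tendsto' ((((hlim (f * f)).add ((hlim (f * g)).mul_const T)).add
    ((hlim (f * g)).const_mul T)).add (((hlim (g * g)).const_mul T).mul_const T)) fun n => ?_
  simp only [hsum, Finset.sum_mul, Finset.mul_sum, ← Finset.sum_add_distrib]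
  refine Finset.sum_nonneg fun k _ => ?_
  have hF : 0 ≤ L (bernstein n k) := hL _ fun x => bernstein_nonneg
  set u := f (bernstein.z k)
  set v := g (bernstein.z k)
  have hs : IsSelfAdjoint (algebraMap ℝ A u + v • T) :=
    (IsSelfAdjoint.algebraMap A (.all u)).add ((IsSelfAdjoint.all v).smul hT)
  convert! hs.conjugate_nonneg hF using 1
  simp only [ContinuousMap.mul_apply, Algebra.algebraMap_eq_smul_one, add_mul, mul_add,
    smul_mul_assoc, mul_smul_comm, one_mul, mul_one, smul_smul, smul_add]
  module

open unitInterval in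
theorem PositiveLinearMap.quadratic_form_nonneg (Φ : A →ₚ[ℂ] A) {Y T : A} (hY : 0 ≤ Y)
    (hT : IsSelfAdjoint T) {f g : ℝ → ℝ} (hf : ContinuousOn f (Set.Ici 0))
    (hg : ContinuousOn g (Set.Ici 0)) :
    0 ≤ Φ (cfc (fun x => f x * f x) Y) + Φ (cfc (fun x => f x * g x) Y) * T +
      T * Φ (cfc (fun x => f x * g x) Y) + T * Φ (cfc (fun x => g x * g x) Y) * T := by
  let c := ‖Y‖ + 1
  have hc : 0 < c := by positivity
  have hsa : IsSelfAdjoint Y := .of_nonneg hY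
  let ι : C(spectrum ℝ Y, I) :=
    ⟨fun x => Set.projIcc 0 1 zero_le_one (x / c), by fun_prop⟩
  have hι (x : spectrum ℝ Y) : c * (ι x : ℝ) = x := by
    have h0 : (0 : ℝ) ≤ x := spectrum_nonneg_of_nonneg hY x.2
    have h1 : (x : ℝ) ≤ c := by
      have := spectrum.norm_le_norm_mul_of_mem x.2
      have h2 : ‖(1 : A)‖ ≤ 1 := by
        nontriviality A
        simp
      rw [Real.norm_of_nonneg h0] at this
      nlinarith [norm_nonneg Y]
    have : (ι x : ℝ) = x / c := by
      simp only [ι, ContinuousMap.coe_mk]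
      rw [Set.projIcc_of_mem zero_le_one ⟨by positivity, (div_le_one hc).2 h1⟩]
    rw [this]; field_simp
  let ev (h : ℝ → ℝ) (hh : ContinuousOn h (Set.Ici 0)) : C(I, ℝ) :=
    ⟨fun x => h (c * x), hh.comp_continuous (by fun_prop) fun x => mul_nonneg hc.le x.2.1⟩
  let L : C(I, ℝ) →L[ℝ] A :=
    { toFun := fun h => Φ (cfcHom (R := ℝ) hsa (h.comp ι))
      map_add' := fun a b => by rw [ContinuousMap.add_comp, map_add, map_add]
      map_smul' := fun a b => by
        rw [ContinuousMap.smul_comp, map_smul]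
        exact LinearMap.map_smul_of_tower Φ.toLinearMap a _
      cont := by
        have h1 : Continuous Φ := map_continuous Φ
        exact h1.comp ((cfcHom_continuous hsa).comp (ContinuousMap.continuous_precomp ι)) }
  have hLc (h : ℝ → ℝ) (hh : ContinuousOn h (Set.Ici 0)) : L (ev h hh) = Φ (cfc h Y) := by
    rw [cfc_apply h Y hsa (hh.mono fun x hx => spectrum_nonneg_of_nonneg hY hx)]
    change Φ _ = Φ _
    congr 2
    ext x
    simp [ev, hι]
  have hpos : ∀ h, 0 ≤ h → 0 ≤ L h := fun h hh =>
    map_nonneg Φ ((cfcHom_nonneg_iff hsa).2 fun x => hh _)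
  have key := _root_.quadratic_form_nonneg L hpos hT (ev f hf) (ev g hg)
  rw [← hLc (fun x => f x * f x) (hf.mul hf), ← hLc (fun x => f x * g x) (hf.mul hg),
    ← hLc (fun x => g x * g x) (hg.mul hg)]
  exact key

/-- Kadison's inequality for positive elements. -/
theorem PositiveLinearMap.map_mul_self_le (Φ : A →ₚ[ℂ] A) (h1 : Φ 1 = 1) {Y : A} (hY : 0 ≤ Y) :
    Φ Y * Φ Y ≤ Φ (Y * Y) := by
  have hT : IsSelfAdjoint (Φ Y) := .of_nonneg (map_nonneg Φ hY)
  have key := Φ.quadratic_form_nonneg hY hT (f := fun x => x) (g := fun _ => -1)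
    continuousOn_id continuousOn_const
  have e1 : cfc (fun x : ℝ => x * x) Y = Y * Y := by
    rw [cfc_mul (fun x : ℝ => x) (fun x : ℝ => x) Y, cfc_id' ℝ Y]
  have e2 : cfc (fun x : ℝ => x * -1) Y = -Y := by
    simp only [mul_neg_one]
    rw [cfc_neg (fun x : ℝ => x) Y, cfc_id' ℝ Y]
  have e3 : cfc (fun x : ℝ => (-1 : ℝ) * -1) Y = 1 := by
    simp only [neg_mul_neg, mul_one]
    exact cfc_const_one ℝ Y
  rw [e1, e2, e3, h1, map_neg] at key
  rw [← sub_nonneg]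
  convert! key using 1
  noncomm_ring

/-- Choi's inequality `Φ(t + Y)⁻¹ ≤ Φ((t + Y)⁻¹)`. -/
theorem PositiveLinearMap.ringInverse_map_le (Φ : A →ₚ[ℂ] A) (h1 : Φ 1 = 1) {Y : A} (hY : 0 ≤ Y)
    {t : ℝ} (ht : 0 < t) :
    cfc (fun x : ℝ => (t + x)⁻¹) (Φ Y) ≤ Φ (cfc (fun x : ℝ => (t + x)⁻¹) Y) := by
  have hΦY := map_nonneg Φ hY
  have hsa : IsSelfAdjoint (Φ Y) := .of_nonneg hΦY
  have hcont {Z : A} (hZ : 0 ≤ Z) : ContinuousOn (fun x : ℝ => (t + x)⁻¹) (spectrum ℝ Z) := by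
    refine ContinuousOn.inv₀ (by fun_prop) fun x hx => ?_
    have := spectrum_nonneg_of_nonneg hZ hx
    positivity
  set T := cfc (fun x : ℝ => (t + x)⁻¹) (Φ Y) with hT
  have hTsa : IsSelfAdjoint T := cfc_predicate _ _
  have key := Φ.quadratic_form_nonneg hY hTsa (f := fun x => √((t + x)⁻¹))
    (g := fun x => -√(t + x))
    (by
      refine ContinuousOn.sqrt (ContinuousOn.inv₀ (by fun_prop) fun x hx => ?_)
      have : 0 ≤ x := hx
      positivity)
    (by fun_prop)
  have hadd {Z : A} (hZ : 0 ≤ Z) : cfc (fun x : ℝ => t + x) Z = algebraMap ℝ A t + Z := by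
    rw [cfc_const_add t (fun x => x) Z, cfc_id' ℝ Z]
  have e1 : cfc (fun x : ℝ => √((t + x)⁻¹) * √((t + x)⁻¹)) Y = cfc (fun x : ℝ => (t + x)⁻¹) Y := by
    refine cfc_congr fun x hx => ?_
    have := spectrum_nonneg_of_nonneg hY hx
    exact Real.mul_self_sqrt (by positivity)
  have e2 : cfc (fun x : ℝ => √((t + x)⁻¹) * -√(t + x)) Y = -1 := by
    have : cfc (fun x : ℝ => √((t + x)⁻¹) * -√(t + x)) Y = cfc (fun x : ℝ => -(1 : ℝ)) Y := by
      refine cfc_congr fun x hx => ?_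
      have := spectrum_nonneg_of_nonneg hY hx
      have h2 : 0 < √(t + x) := Real.sqrt_pos.2 (by positivity)
      simp only [Real.sqrt_inv]
      field_simp
    rw [this, cfc_neg, cfc_const_one ℝ Y]
  have e3 : cfc (fun x : ℝ => -√(t + x) * -√(t + x)) Y = algebraMap ℝ A t + Y := by
    rw [← hadd hY]
    refine cfc_congr fun x hx => ?_
    have := spectrum_nonneg_of_nonneg hY hx
    simp only [neg_mul_neg]
    exact Real.mul_self_sqrt (by positivity)
  have e4 : Φ (algebraMap ℝ A t + Y) = algebraMap ℝ A t + Φ Y := by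
    rw [map_add, Algebra.algebraMap_eq_smul_one]
    congr 1
    exact (LinearMap.map_smul_of_tower Φ.toLinearMap t 1).trans (congrArg (t • ·) h1)
  have e5 : T * (algebraMap ℝ A t + Φ Y) = 1 := by
    rw [← hadd hΦY, hT, ← cfc_mul _ _ _ (hcont hΦY), ← cfc_const_one ℝ (Φ Y)]
    refine cfc_congr fun x hx => ?_
    have := spectrum_nonneg_of_nonneg hΦY hx
    have : t + x ≠ 0 := by positivity
    simp [this]
  rw [e1, e2, e3, e4, e5, map_neg, h1] at key
  rw [← sub_nonneg]
  convert! key using 1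
  noncomm_ring

open MeasureTheory in
/-- Jensen's operator inequality for the power functions with exponent in `[1, 2]`. -/
theorem PositiveLinearMap.rpow_map_le (Φ : A →ₚ[ℂ] A) (h1 : Φ 1 = 1) {Y : A} (hY : 0 ≤ Y)
    {p : ℝ} (hp1 : 1 ≤ p) (hp2 : p ≤ 2) : (Φ Y) ^ p ≤ Φ (Y ^ p) := by
  have hΦY := map_nonneg Φ hY
  rcases hp1.eq_or_lt with rfl | hp1
  · rw [CFC.rpow_one Y, CFC.rpow_one _ hΦY]
  rcases hp2.eq_or_lt with rfl | hp2
  · have h2 {Z : A} (hZ : 0 ≤ Z) : Z ^ (2 : ℝ) = Z * Z := by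
      have := CFC.rpow_natCast Z 2
      rw [← pow_two, ← this]; norm_num
    rw [h2 hY, h2 hΦY]
    exact Φ.map_mul_self_le h1 hY
  lift p to ℝ≥0 using by linarith
  obtain ⟨μ, hμ⟩ := CFC.exists_measure_nnrpow_eq_integral_cfcₙ_rpowIntegrand₁₂ A (p := p)
    ⟨by exact_mod_cast hp1, by exact_mod_cast hp2⟩
  have hp0 : 0 < p := by
    rw [← NNReal.coe_pos]; linarith
  let Ψ : A →L[ℝ] A := ⟨Φ.toLinearMap.restrictScalars ℝ, map_continuous Φ⟩
  have hsmul (s : ℝ) (a : A) : Φ (s • a) = s • Φ a :=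
    LinearMap.map_smul_of_tower Φ.toLinearMap s a
  rw [← CFC.nnrpow_eq_rpow hp0, ← CFC.nnrpow_eq_rpow hp0, (hμ _ hΦY).2, (hμ _ hY).2]
  change _ ≤ Ψ _
  rw [← Ψ.integral_comp_comm (hμ _ hY).1]
  refine integral_mono_ae (hμ _ hΦY).1 (Ψ.integrable_comp (hμ _ hY).1) ?_
  filter_upwards [ae_restrict_mem measurableSet_Ioi] with t ht
  have ht : 0 < t := ht
  have hcfc {Z : A} (hZ : 0 ≤ Z) : cfcₙ (Real.rpowIntegrand₁₂ p t) Z =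
      t ^ ((p : ℝ) - 1) • (t⁻¹ • Z + t • cfc (fun x : ℝ => (t + x)⁻¹) Z - 1) := by
    have hcont : ContinuousOn (fun x : ℝ => (t + x)⁻¹) (spectrum ℝ Z) := by
      refine ContinuousOn.inv₀ (by fun_prop) fun x hx => ?_
      have := spectrum_nonneg_of_nonneg hZ hx
      positivity
    have hqsub : quasispectrum ℝ Z ⊆ Set.Ici 0 := fun x hx =>
      quasispectrum_nonneg_of_nonneg Z hZ x hx
    rw [cfcₙ_eq_cfc
      (hf := by
        have := (Real.continuousOn_rpowIntegrand₁₂_uncurry (p := p) hp1 (quasispectrum ℝ Z) hqsub)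
        exact this.uncurry_left t ht)
      (hf0 := Real.rpowIntegrand₁₂_zero ht)]
    unfold Real.rpowIntegrand₁₂
    rw [cfc_const_mul _ _ _ (by fun_prop), cfc_sub _ _ _ (by fun_prop) (by fun_prop),
      cfc_add _ _ _ (by fun_prop) (by fun_prop), cfc_const_mul _ _ Z, cfc_id' ℝ Z,
      cfc_const_mul _ _ _ hcont, cfc_const_one ℝ Z]
  change _ ≤ Φ _
  rw [hcfc hΦY, hcfc hY, hsmul, map_sub, map_add, hsmul, hsmul, h1]
  gcongr
  exact Φ.ringInverse_map_le h1 hY ht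

end Jensen

section Refinement

variable {A : Type*} [CStarAlgebra A] [PartialOrder A] [StarOrderedRing A]

theorem rpow_sub_rpow_sub_antitone_s17 {s d t u : ℝ} (hs0 : 0 ≤ s) (hs1 : s ≤ 1) (hd : 0 ≤ d)
    (hdt : d ≤ t) (htu : t ≤ u) : u ^ s - (u - d) ^ s ≤ t ^ s - (t - d) ^ s := by
  rcases htu.eq_or_lt with rfl | htu
  · rfl
  rcases hd.eq_or_lt with rfl | hd
  · simp
  have hc := Real.concaveOn_rpow hs0 hs1
  set l := d / (u - t + d) with hl
  have hden : 0 < u - t + d := by linarith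
  have hl0 : 0 ≤ l := by positivity
  have hl1 : 0 ≤ 1 - l := by
    rw [sub_nonneg, hl, div_le_one hden]; linarith
  have hmul : l * (u - t + d) = d := div_mul_cancel₀ _ hden.ne'
  have ha : (0 : ℝ) ≤ t - d := by linarith
  have hb : (0 : ℝ) ≤ u := by linarith
  have h1 := hc.2 (x := t - d) ha (y := u) hb hl1 hl0 (by ring)
  have h2 := hc.2 (x := t - d) ha (y := u) hb hl0 hl1 (by ring)
  simp only [smul_eq_mul] at h1 h2
  rw [show (1 - l) * (t - d) + l * u = t by linear_combination hmul] at h1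
  rw [show l * (t - d) + (1 - l) * u = u - d by linear_combination -hmul] at h2
  linarith

/-- A quantitative Löwner–Heinz inequality. -/
theorem rpow_add_smul_one_le_rpow [Nontrivial A] {P Q : A} (hQ : 0 ≤ Q) {d s : ℝ} (hd : 0 ≤ d)
    (hQP : Q + d • 1 ≤ P) (hs0 : 0 ≤ s) (hs1 : s ≤ 1) :
    d ≤ ‖P‖ ∧ Q ^ s + (‖P‖ ^ s - (‖P‖ - d) ^ s) • 1 ≤ P ^ s := by
  have hdP : d • (1 : A) ≤ P := le_trans (le_add_of_nonneg_left hQ) hQP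
  have hP : 0 ≤ P := (smul_nonneg hd zero_le_one).trans hdP
  have hsa : IsSelfAdjoint P := .of_nonneg hP
  have hspec : ∀ x ∈ spectrum ℝ P, d ≤ x := by
    rw [← algebraMap_le_iff_le_spectrum, Algebra.algebraMap_eq_smul_one]
    exact hdP
  have hspec' : ∀ x ∈ spectrum ℝ P, x ≤ ‖P‖ := by
    rw [← le_algebraMap_iff_spectrum_le]
    exact hsa.le_algebraMap_norm_self
  refine ⟨hspec _ (CStarAlgebra.norm_mem_spectrum_of_nonneg hP), ?_⟩
  have hcont : ContinuousOn (fun x : ℝ => (x - d) ^ s) (spectrum ℝ P) := by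
    exact (Continuous.rpow_const (by fun_prop) fun _ => Or.inr hs0).continuousOn
  have hcont' : ContinuousOn (fun x : ℝ => x ^ s) (spectrum ℝ P) := by
    exact (Continuous.rpow_const (by fun_prop) fun _ => Or.inr hs0).continuousOn
  have hsub : cfc (fun x : ℝ => x - d) P = P - d • 1 := by
    rw [cfc_sub _ _ P, cfc_id' ℝ P, cfc_const d P, Algebra.algebraMap_eq_smul_one]
  have h1 : Q ^ s ≤ cfc (fun x : ℝ => (x - d) ^ s) P := by
    have hQ' : Q ≤ P - d • 1 := le_sub_iff_add_le.2 hQP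
    refine (CFC.rpow_le_rpow ⟨hs0, hs1⟩ hQ').trans_eq ?_
    rw [CFC.rpow_eq_cfc_real (hQ.trans hQ'), ← hsub,
      ← cfc_comp' (fun x : ℝ => x ^ s) (fun x : ℝ => x - d) P
        (Continuous.rpow_const (by fun_prop) fun _ => Or.inr hs0).continuousOn]
  have h2 : (‖P‖ ^ s - (‖P‖ - d) ^ s) • (1 : A) ≤
      cfc (fun x : ℝ => x ^ s - (x - d) ^ s) P := by
    rw [← Algebra.algebraMap_eq_smul_one]
    refine algebraMap_le_cfc _ _ P (fun x hx => ?_) (hcont'.sub hcont)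
    exact rpow_sub_rpow_sub_antitone_s17 hs0 hs1 hd (hspec x hx) (hspec' x hx)
  rw [cfc_sub _ _ P hcont' hcont, ← CFC.rpow_eq_cfc_real hP] at h2
  calc _ ≤ _ := add_le_add h1 h2
    _ = _ := by abel

theorem inv_norm_ringInverse_smul_one_le [Nontrivial A] {M : A} (hM : IsStrictlyPositive M) :
    ‖Ring.inverse M‖⁻¹ • (1 : A) ≤ M := by
  have hpos : 0 < ‖Ring.inverse M‖ := norm_pos_iff.2 (by
    intro h
    have := Ring.inverse_mul_cancel M hM.isUnit
    rw [h, zero_mul] at this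
    exact zero_ne_one this)
  rw [← Algebra.algebraMap_eq_smul_one, algebraMap_le_iff_le_spectrum]
  intro x hx
  have hx0 : 0 < x := by
    refine (spectrum_nonneg_of_nonneg hM.nonneg hx).lt_of_ne' ?_
    rintro rfl
    exact spectrum.zero_notMem ℝ hM.isUnit hx
  have h : x⁻¹ ∈ spectrum ℝ (Ring.inverse M) := by
    obtain ⟨u, rfl⟩ := hM.isUnit
    rw [Ring.inverse_unit]
    lift x to ℝˣ using isUnit_iff_ne_zero.2 hx0.ne'
    simpa using (spectrum.inv_mem_iff.2 (by simpa using hx))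
  have h2 := spectrum.norm_le_norm_of_mem h
  rw [norm_inv, Real.norm_of_nonneg hx0.le] at h2
  exact inv_le_of_inv_le₀ hx0 h2

theorem add_iInf_smul_one_le [Nontrivial A] {Q B : A} (h : Q ≤ B) :
    Q + (⨅ n : ℕ+, ‖Ring.inverse (B + ((n : ℕ) : ℝ)⁻¹ • (1 : A) - Q)‖⁻¹) • 1 ≤ B := by
  have hbdd : BddBelow (Set.range fun n : ℕ+ =>
      ‖Ring.inverse (B + ((n : ℕ) : ℝ)⁻¹ • (1 : A) - Q)‖⁻¹) :=
    ⟨0, by rintro _ ⟨n, rfl⟩; positivity⟩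
  have hle (n : ℕ) :
      Q + (⨅ n : ℕ+, ‖Ring.inverse (B + ((n : ℕ) : ℝ)⁻¹ • (1 : A) - Q)‖⁻¹) • 1 ≤
        B + (1 / ((n : ℝ) + 1)) • (1 : A) := by
    have hM : IsStrictlyPositive (B + ((n.succPNat : ℕ) : ℝ)⁻¹ • (1 : A) - Q) := by
      have h0 : IsStrictlyPositive (((n.succPNat : ℕ) : ℝ)⁻¹ • (1 : A)) :=
        IsStrictlyPositive.smul (inv_pos.2 (by exact_mod_cast n.succPNat.pos)) isStrictlyPositive_one
      refine h0.of_le ?_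
      rw [le_sub_iff_add_le, add_comm]
      gcongr
    have h1 := (smul_le_smul_of_nonneg_right (ciInf_le hbdd n.succPNat)
      (zero_le_one (α := A))).trans (inv_norm_ringInverse_smul_one_le hM)
    rw [le_sub_iff_add_le, add_comm] at h1
    simpa using h1
  refine ge_of_tendsto' (x := Filter.atTop) ?_ hle
  simpa using (tendsto_one_div_add_atTop_nhds_zero_nat (𝕜 := ℝ)).smul_const (1 : A) |>.const_add B

theorem rpow_smul_one_le_mul_self [Nontrivial A] {B : A} (hB : IsStrictlyPositive B) {r : ℝ}
    (hr : 0 < r) : ‖B ^ (-r)‖ ^ (-2 / r) • (1 : A) ≤ B * B := by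
  have hBn := hB.nonneg
  have h1 : B * B = cfc (fun x : ℝ => x * x) B := by
    rw [cfc_mul (fun x : ℝ => x) (fun x : ℝ => x) B, cfc_id' ℝ B]
  rw [h1, ← Algebra.algebraMap_eq_smul_one]
  refine algebraMap_le_cfc _ _ B (fun x hx => ?_)
  have hx0 : 0 < x := by
    refine (spectrum_nonneg_of_nonneg hBn hx).lt_of_ne' ?_
    rintro rfl
    exact spectrum.zero_notMem ℝ hB.isUnit hx
  have hmem : x ^ (-r) ∈ spectrum ℝ (B ^ (-r)) := by
    rw [CFC.rpow_eq_cfc_real hBn, cfc_map_spectrum (fun x : ℝ => x ^ (-r)) B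
      (hf := continuousOn_id.rpow_const fun t ht => Or.inl ?_)]
    · exact ⟨x, hx, rfl⟩
    · rintro rfl
      exact spectrum.zero_notMem ℝ hB.isUnit ht
  have h2 := spectrum.norm_le_norm_of_mem hmem
  rw [Real.norm_of_nonneg (by positivity)] at h2
  calc ‖B ^ (-r)‖ ^ (-2 / r) ≤ (x ^ (-r)) ^ (-2 / r) :=
        Real.rpow_le_rpow_of_nonpos (by positivity) h2
          (div_nonpos_of_nonpos_of_nonneg (by norm_num) hr.le)
    _ = x * x := by
        rw [← Real.rpow_mul hx0.le, show -r * (-2 / r) = ((2 : ℕ) : ℝ) by push_cast; field_simp,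
          Real.rpow_natCast, pow_two]

theorem PositiveLinearMap.isStrictlyPositive_map [Nontrivial A] (Φ : A →ₚ[ℂ] A)
    (h1 : Φ 1 = 1) {Y : A} (hY : IsStrictlyPositive Y) : IsStrictlyPositive (Φ Y) := by
  obtain ⟨m, hm, hmY⟩ := (CFC.exists_pos_algebraMap_le_iff hY.isSelfAdjoint).2 fun x hx =>
    (spectrum_nonneg_of_nonneg hY.nonneg hx).lt_of_ne' fun h =>
      spectrum.zero_notMem ℝ hY.isUnit (h ▸ hx)
  have h : Φ (algebraMap ℝ A m) = m • 1 := by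
    rw [Algebra.algebraMap_eq_smul_one]
    exact (LinearMap.map_smul_of_tower Φ.toLinearMap m 1).trans (congrArg (m • ·) h1)
  refine (IsStrictlyPositive.smul hm isStrictlyPositive_one).of_le (h.ge.trans ?_)
  exact OrderHomClass.mono Φ hmY

theorem sqrt_star_mul_self_add_smul_one_le [Nontrivial A] {B C : A} (hC : IsStrictlyPositive C)
    {r : ℝ} (hr : 1 / 2 ≤ r) (hr1 : r ≤ 1) (hCB : C ^ (1 / r) ≤ B) :
    CFC.sqrt (star (C * B) * (C * B)) +
        (‖B ^ (1 + r)‖ - ‖B ^ (2 + r) -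
          ((‖B‖ ^ r - (‖B‖ - ⨅ n : ℕ+,
              ‖Ring.inverse (B + ((n : ℕ) : ℝ)⁻¹ • (1 : A) - C ^ (1 / r))‖⁻¹) ^ r) *
            ‖B ^ (-r)‖ ^ (-2 / r)) • (1 : A)‖ ^ ((1 + r) / (2 + r))) • (1 : A) ≤
      B ^ (1 + r) := by
  have hr0 : 0 < r := by linarith
  have hQ : IsStrictlyPositive (C ^ (1 / r)) := hC.rpow C _
  have hQr : (C ^ (1 / r)) ^ r = C := by
    rw [CFC.rpow_rpow C _ _ (by positivity), one_div_mul_cancel hr0.ne', CFC.rpow_one C]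
  have hB : IsStrictlyPositive B := hQ.of_le hCB
  have hBu := hB.isUnit
  have hgap := add_iInf_smul_one_le hCB
  have habs := sqrt_conj_sq_le hQ hCB hr hr1
  have hd : 0 ≤ ⨅ n : ℕ+, ‖Ring.inverse (B + ((n : ℕ) : ℝ)⁻¹ • (1 : A) - C ^ (1 / r))‖⁻¹ :=
    Real.iInf_nonneg fun n => by positivity
  set d := ⨅ n : ℕ+, ‖Ring.inverse (B + ((n : ℕ) : ℝ)⁻¹ • (1 : A) - C ^ (1 / r))‖⁻¹
  obtain ⟨hdB, hω⟩ := rpow_add_smul_one_le_rpow hQ.nonneg hd hgap hr0.le hr1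
  rw [hQr] at hω habs
  have hω0 : 0 ≤ ‖B‖ ^ r - (‖B‖ - d) ^ r :=
    sub_nonneg.2 (Real.rpow_le_rpow (by linarith) (by linarith) hr0.le)
  set ω := ‖B‖ ^ r - (‖B‖ - d) ^ r
  have hB2 := rpow_smul_one_le_mul_self hB hr0
  have hκ0 : 0 ≤ ‖B ^ (-r)‖ ^ (-2 / r) := by positivity
  set κ := ‖B ^ (-r)‖ ^ (-2 / r)
  have hU : B ^ (2 + r) = B * B ^ r * B := by
    conv_rhs => rw [← CFC.rpow_one B]
    rw [CFC.rpow_rpow B 1 _ one_ne_zero, ← CFC.rpow_add hBu, ← CFC.rpow_add hBu]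
    ring_nf
  have hδ : B * C * B + (ω * κ) • 1 ≤ B ^ (2 + r) := by
    rw [hU]
    calc B * C * B + (ω * κ) • 1 = B * C * B + ω • κ • 1 := by rw [smul_smul]
      _ ≤ B * C * B + ω • (B * B) := by gcongr
      _ = B * (C + ω • 1) * B := by
        simp only [mul_add, add_mul, mul_smul_comm, smul_mul_assoc, mul_one]
      _ ≤ _ := hB.isSelfAdjoint.conjugate_le_conjugate hω
  have hV : 0 ≤ B * C * B := hB.isSelfAdjoint.conjugate_nonneg hC.nonneg
  have hs : 0 < (1 + r) / (2 + r) := by positivity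
  obtain ⟨hδU, hfin⟩ := rpow_add_smul_one_le_rpow hV (mul_nonneg hω0 hκ0) hδ hs.le
    (by rw [div_le_one] <;> linarith)
  have hUs : (B ^ (2 + r)) ^ ((1 + r) / (2 + r)) = B ^ (1 + r) := by
    rw [CFC.rpow_rpow B _ _ (by positivity), mul_div_cancel₀ _ (by positivity)]
  have hnorm : ‖B ^ (1 + r)‖ = ‖B ^ (2 + r)‖ ^ ((1 + r) / (2 + r)) := by
    rw [← hUs, CFC.norm_rpow _ hs CFC.rpow_nonneg]
  have htri : ‖B ^ (2 + r)‖ - ω * κ ≤ ‖B ^ (2 + r) - (ω * κ) • (1 : A)‖ := by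
    have := norm_sub_norm_le (B ^ (2 + r)) ((ω * κ) • (1 : A))
    rwa [norm_smul, norm_one, mul_one, Real.norm_of_nonneg (mul_nonneg hω0 hκ0)] at this
  rw [hUs] at hfin
  refine le_trans (add_le_add habs (smul_le_smul_of_nonneg_right ?_ zero_le_one)) hfin
  rw [hnorm]
  gcongr

end Refinement

/-- **Theorem 3.8 (refined asymmetric Kadison inequality).** If `X` is positive invertible and
`0 ≤ β < α ≤ 2β`, then
`Φ(X^α)^(1+β/α) ≥ |Φ(X^β) Φ(X^α)| + (‖Φ(X^α)^(1+β/α)‖ −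
  ‖Φ(X^α)^(2+β/α) − ω(X^α, β/α) ‖Φ(X^α)^(−β/α)‖^(−2α/β)‖^((β+α)/(β+2α))) · I`. -/
theorem refined_asymmetric_kadison
    (Φ : (H →L[ℂ] H) →ₗ[ℂ] (H →L[ℂ] H)) (hΦ : IsUnitalPositiveMap Φ)
    (X : H →L[ℂ] H) (hX : 0 ≤ X) (hXu : IsUnit X)
    (α β : ℝ) (hα : 0 ≤ α) (hβ : 0 ≤ β) (hβα : β < α) (hα2β : α ≤ 2 * β) :
    opAbs (Φ (CFC.rpow X β) * Φ (CFC.rpow X α)) +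
        (‖CFC.rpow (Φ (CFC.rpow X α)) (1 + β / α)‖ -
            ‖CFC.rpow (Φ (CFC.rpow X α)) (2 + β / α) -
                (omegaConst Φ (CFC.rpow X α) (β / α) *
                    ‖CFC.rpow (Φ (CFC.rpow X α)) (-(β / α))‖ ^ (-(2 * α) / β)) •
                  (1 : H →L[ℂ] H)‖ ^ ((β + α) / (β + 2 * α))) • (1 : H →L[ℂ] H) ≤
      CFC.rpow (Φ (CFC.rpow X α)) (1 + β / α) := by
  rcases subsingleton_or_nontrivial H with _ | _
  · exact le_of_eq (Subsingleton.elim _ _)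
  let Ψ : (H →L[ℂ] H) →ₚ[ℂ] (H →L[ℂ] H) := PositiveLinearMap.mk₀ Φ hΦ.2
  have hXp : IsStrictlyPositive X := ⟨hX, hXu⟩
  have hβ0 : 0 < β := by linarith
  have hα0 : 0 < α := by linarith
  have hr0 : 0 < β / α := by positivity
  have hr : 1 / 2 ≤ β / α := by rw [div_le_div_iff₀ two_pos hα0]; linarith
  have hr1 : β / α ≤ 1 := by rw [div_le_one hα0]; exact hβα.le
  have hXβ : CFC.rpow (CFC.rpow X α) (β / α) = CFC.rpow X β :=
    (CFC.rpow_rpow X _ _ hα0.ne').trans (by rw [mul_div_cancel₀ _ hα0.ne']; rfl)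
  have hXα : (CFC.rpow X β) ^ (1 / (β / α)) = CFC.rpow X α :=
    (CFC.rpow_rpow X _ _ hβ0.ne').trans (by
      rw [show β * (1 / (β / α)) = α by field_simp]; rfl)
  have hC : IsStrictlyPositive (Φ (CFC.rpow X β)) :=
    Ψ.isStrictlyPositive_map hΦ.1 (hXp.rpow X β)
  have hJ : (Φ (CFC.rpow X β)) ^ (1 / (β / α)) ≤ Φ (CFC.rpow X α) := by
    rw [← hXα]
    refine Ψ.rpow_map_le hΦ.1 CFC.rpow_nonneg ?_ ?_
    · rw [le_div_iff₀ hr0]; linarith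
    · rw [div_le_iff₀ hr0]; linarith
  have key := sqrt_star_mul_self_add_smul_one_le hC hr hr1 hJ
  have e1 : -(2 * α) / β = -2 / (β / α) := by field_simp
  have e2 : (β + α) / (β + 2 * α) = (1 + β / α) / (2 + β / α) := by field_simp; ring
  rw [e1, e2, omegaConst, hXβ]
  exact key
end
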